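/- Let L and G be groups with a common subgroup H = L ∩ G, and let R ⊆ L ∗_H G be a half H⁻-separated set whose symmetrized hull R° satisfies condition C'(λ) for some real λ with 0 < λ < 1/6 such that (1 − 6λ)|r| > 4 for every cyclically reduced element r ∈ R°. Let N be the smallest normal subgroup of F∗ = L ∗_H G containing R. If the subgroup H is malnormal in L, then for every x ∈ F∗ \ GN and every y ∈ G \ {e} we have xyx⁻¹ ∉ GN. -/

import Mathlib

open scoped Pointwise

namespace AmalgamFormalization

variable {F : Type u} [Group F]

/-- `u ∼ v`: both elements lie in `L` or both lie in `G`. -/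
def SameFactor (L G : Subgroup F) (u v : F) : Prop :=
  (u ∈ L ∧ v ∈ L) ∨ (u ∈ G ∧ v ∈ G)

/-- A canonical word: a list of elements of `L ∪ G` in which no two consecutive
entries lie in a common factor. -/
def IsCanonicalWord (L G : Subgroup F) (w : List F) : Prop :=
  (∀ x ∈ w, x ∈ (L : Set F) ∪ (G : Set F)) ∧
    w.Chain' fun a b => ¬ SameFactor L G a b

/-- `w` is a canonical representation of `x`. -/
def IsCanonicalRep (L G : Subgroup F) (x : F) (w : List F) : Prop :=
  IsCanonicalWord L G w ∧ w.prod = x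

/-- `F` is (internally) the free product of its subgroups `L` and `G`
amalgamated over `H = L ⊓ G`: it is generated by `L ∪ G` and no nonempty
alternating (canonical) word of length `≥ 2` represents the identity. -/
def IsAmalgam (L G : Subgroup F) : Prop :=
  L ⊔ G = ⊤ ∧ ∀ w : List F, IsCanonicalWord L G w → 2 ≤ w.length → w.prod ≠ 1

/-- The length of an element: the (common) length of its canonical representations. -/
noncomputable def len (L G : Subgroup F) (x : F) : ℕ :=
  sInf {n | ∃ w : List F, IsCanonicalRep L G x w ∧ w.length = n}

/-- An element is cyclically reduced if it has length `≤ 1` or admits a canonical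
representation whose first and last entries lie in no common factor. -/
def IsCyclicallyReduced (L G : Subgroup F) (x : F) : Prop :=
  len L G x ≤ 1 ∨ ∃ w : List F, IsCanonicalRep L G x w ∧
    ∀ a b : F, w.head? = some a → w.getLast? = some b → ¬ SameFactor L G a b

/-- An element is weakly cyclically reduced if it has length `≤ 1` or admits a canonical
representation `x₁ ⋯ xₙ` with `x₁ * xₙ ∉ H`. -/
def IsWeaklyCyclicallyReduced (L G : Subgroup F) (x : F) : Prop :=
  len L G x ≤ 1 ∨ ∃ w : List F, IsCanonicalRep L G x w ∧
    ∀ a b : F, w.head? = some a → w.getLast? = some b → a * b ∉ L ⊓ G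

/-- A set is half-symmetrized if all its elements are weakly cyclically reduced and it
contains every weakly cyclically reduced conjugate of each of its elements. -/
def IsHalfSymmetrized (L G : Subgroup F) (R : Set F) : Prop :=
  (∀ r ∈ R, IsWeaklyCyclicallyReduced L G r) ∧
    ∀ c : F, ∀ r ∈ R, IsWeaklyCyclicallyReduced L G (c * r * c⁻¹) → c * r * c⁻¹ ∈ R

/-- A set is symmetrized if it is half-symmetrized and closed under inverses. -/
def IsSymmetrized (L G : Subgroup F) (R : Set F) : Prop :=
  IsHalfSymmetrized L G R ∧ ∀ r ∈ R, r⁻¹ ∈ R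

/-- The half-symmetrized hull: the smallest half-symmetrized set containing `R`. -/
def halfSymmetrizedHull (L G : Subgroup F) (R : Set F) : Set F :=
  ⋂₀ {S | R ⊆ S ∧ IsHalfSymmetrized L G S}

/-- The symmetrized hull: the smallest symmetrized set containing `R`. -/
def symmetrizedHull (L G : Subgroup F) (R : Set F) : Set F :=
  ⋂₀ {S | R ⊆ S ∧ IsSymmetrized L G S}

/-- `a ≐ b c` : `a = b * c` and `|b| + |c| - 1 ≤ |a| ≤ |b| + |c|`. -/
def DotEq (L G : Subgroup F) (a b c : F) : Prop :=
  a = b * c ∧ len L G b + len L G c - 1 ≤ len L G a ∧ len L G a ≤ len L G b + len L G c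

/-- `p` is an `R`-piece of `r`. -/
def IsPieceOf (L G : Subgroup F) (R : Set F) (p r : F) : Prop :=
  ∃ q ∈ R, q ≠ r ∧ (∃ x, DotEq L G r p x) ∧ ∃ y, DotEq L G q p y

/-- The small cancellation condition `C'(λ)`. -/
def CondC' (L G : Subgroup F) (R : Set F) (lam : ℝ) : Prop :=
  (∀ r ∈ R, 1 / lam < (len L G r : ℝ)) ∧
    ∀ r ∈ R, ∀ p : F, IsPieceOf L G R p r → (len L G p : ℝ) < lam * (len L G r : ℝ)

/-- `H` is a malnormal subgroup of `K`. -/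
def MalnormalIn (H K : Subgroup F) : Prop :=
  ∀ x ∈ K, x ∉ H → ∀ h ∈ H, x * h * x⁻¹ ∈ H → h = 1

/-- An element `g` is `H`-malnormal: `g ∉ H` and `H ∩ gHg⁻¹ = {e}`. -/
def IsHMalnormal (H : Subgroup F) (g : F) : Prop :=
  g ∉ H ∧ ∀ h ∈ H, g * h * g⁻¹ ∈ H → h = 1

/-- A sequence `(g i)` is `H^±`-separated: `g i ∉ H (g j) H ∪ H (g j)⁻¹ H` for `i ≠ j`. -/
def HPMSeparated (H : Subgroup F) {n : ℕ} (g : Fin n → F) : Prop :=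
  ∀ i j : Fin n, i ≠ j →
    g i ∉ ((H : Set F) * {g j} * (H : Set F)) ∪ ((H : Set F) * {(g j)⁻¹} * (H : Set F))

/-- An element of positive even length is half `H⁻`-separated. -/
def IsHalfHMinusSeparated (L G : Subgroup F) (r : F) : Prop :=
  ∃ (n : ℕ) (x : Fin n → F), IsCanonicalRep L G r (List.ofFn x) ∧
    ∃ ε : Fin n, (ε : ℕ) ≤ 1 ∧
      ∀ i j : Fin n, Even (i : ℕ) → Even (j : ℕ) → i ≠ j →
        (x (ε + i))⁻¹ ∉
          ((L ⊓ G : Subgroup F) : Set F) * {x (ε + j)} * ((L ⊓ G : Subgroup F) : Set F)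

/-- A set is half `H⁻`-separated if each of its elements has positive even length and
is half `H⁻`-separated. -/
def IsHalfHMinusSeparatedSet (L G : Subgroup F) (R : Set F) : Prop :=
  ∀ r ∈ R, 0 < len L G r ∧ Even (len L G r) ∧ IsHalfHMinusSeparated L G r

end AmalgamFormalization

namespace AmalgamFormalization

/-! ### Tree metrics -/

/-- An integer valued tree metric. -/
structure TreeDist {V : Type*} (d : V → V → ℕ) : Prop where
  self : ∀ x, d x x = 0
  eq : ∀ x y, d x y = 0 → x = y
  symm : ∀ x y, d x y = d y x
  tri : ∀ x y z, d x z ≤ d x y + d y z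
  med : ∀ a b c, ∃ m, d a m + d m b = d a b ∧ d a m + d m c = d a c ∧ d b m + d m c = d b c
  fp : ∀ a b c e, d a b + d c e ≤ max (d a c + d b e) (d a e + d b c)
  step : ∀ a b, a ≠ b → ∃ x, d a x = 1 ∧ d a x + d x b = d a b

/-- `z` lies on the segment from `x` to `y`. -/
def Btw {V : Type*} (d : V → V → ℕ) (x z y : V) : Prop := d x z + d z y = d x y

/-- Convex subsets. -/
def Conv {V : Type*} (d : V → V → ℕ) (S : Set V) : Prop :=
  ∀ x ∈ S, ∀ y ∈ S, ∀ z, Btw d x z y → z ∈ S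

/-- `π` is the projection of `y` to `S`. -/
def Gate {V : Type*} (d : V → V → ℕ) (S : Set V) (y π : V) : Prop :=
  π ∈ S ∧ ∀ z ∈ S, Btw d y π z

namespace TreeDist

variable {V : Type*} {d : V → V → ℕ}

theorem btw_symm (h : TreeDist d) {x z y : V} (hz : Btw d x z y) : Btw d y z x := by
  unfold Btw at *
  rw [h.symm y z, h.symm z x, h.symm y x]; omega

theorem btw_cover (h : TreeDist d) {x z y : V} (hz : Btw d x z y) (w : V) :
    Btw d x z w ∨ Btw d w z y := by
  unfold Btw at *
  have h1 := h.fp z w x y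
  have h2 := h.symm z x
  have h3 := h.symm z w
  have h4 := h.symm w x
  have h5 := h.tri x z w
  have h6 := h.tri w z y
  rcases le_max_iff.1 h1 with h1 | h1
  · right; omega
  · left; omega

theorem uniq (h : TreeDist d) {a c x y : V} (hx : Btw d a x c) (hy : Btw d a y c)
    (hxy : d a x = d a y) : x = y := by
  unfold Btw at *
  apply h.eq
  have h1 := h.fp x y a c
  have h2 := h.symm x a
  have h3 := h.symm y a
  rcases le_max_iff.1 h1 with h1 | h1 <;> omega

theorem gate_exists (h : TreeDist d) {S : Set V} (hS : Conv d S) (hne : S.Nonempty) (y : V) :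
    ∃ π, Gate d S y π := by
  classical
  obtain ⟨s0, hs0⟩ := hne
  have hex : ∃ n, ∃ s ∈ S, d y s = n := ⟨_, s0, hs0, rfl⟩
  obtain ⟨π, hπ, hn⟩ := Nat.find_spec hex
  refine ⟨π, hπ, fun z hz => ?_⟩
  obtain ⟨m, h1, h2, h3⟩ := h.med y π z
  have hm : m ∈ S := hS π hπ z hz m h3
  have h4 : Nat.find hex ≤ d y m := Nat.find_min' hex ⟨m, hm, rfl⟩
  have h5 : m = π := h.eq _ _ (by omega)
  subst h5
  exact h2

theorem gate_sub (h : TreeDist d) {S T : Set V} (hT : Conv d T) {y π x : V} (hg : Gate d S y π)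
    (hy : y ∈ T) (hx : x ∈ T) (hxS : x ∈ S) : π ∈ T :=
  hT y hy x hx π (hg.2 x hxS)

theorem gate_uniq (h : TreeDist d) {S : Set V} {y π π' : V} (hg : Gate d S y π)
    (hg' : Gate d S y π') : π = π' := by
  have h1 := hg.2 _ hg'.1
  have h2 := hg'.2 _ hg.1
  unfold Btw at *
  apply h.eq
  have := h.symm π π'
  omega

theorem gate_btw (h : TreeDist d) {S : Set V} {a b α β : V} (ha : Gate d S a α)
    (hb : Gate d S b β) (hne : α ≠ β) : d a b = d a α + d α β + d β b := by
  have h1 := ha.2 _ hb.1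
  have h2 := hb.2 _ ha.1
  have h3 : d α β ≠ 0 := fun hh => hne (h.eq _ _ hh)
  unfold Btw at *
  have h4 := h.fp a β b α
  have h5 := h.symm α β
  have h6 := h.symm β b
  have h7 := h.tri a α b
  have h8 := h.tri α β b
  rcases le_max_iff.1 h4 with h4 | h4 <;> omega

theorem gate_of_btw (h : TreeDist d) {S : Set V} {y π x : V} (hg : Gate d S y π)
    (hx : Btw d y x π) : Gate d S x π := by
  refine ⟨hg.1, fun z hz => ?_⟩
  have h1 := hg.2 z hz
  unfold Btw at *
  have h2 := h.tri y x z
  have h3 := h.tri x π z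
  omega

theorem helly (h : TreeDist d) {S T U : Set V} (hS : Conv d S) (hT : Conv d T) (hU : Conv d U)
    {x y z : V} (hx1 : x ∈ S) (hx2 : x ∈ T) (hy1 : y ∈ S) (hy2 : y ∈ U)
    (hz1 : z ∈ T) (hz2 : z ∈ U) : ∃ m, m ∈ S ∧ m ∈ T ∧ m ∈ U := by
  obtain ⟨m, h1, h2, h3⟩ := h.med x y z
  exact ⟨m, hS x hx1 y hy1 m h1, hT x hx2 z hz1 m h2, hU y hy2 z hz2 m h3⟩

end TreeDist

/-! ### The windmill argument -/

/-- Small cancellation data: a group acting on a tree, with a family of convex subsets. -/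
structure Mill {F V : Type*} [Group F] [MulAction F V] (d : V → V → ℕ) (RR : Set F)
    (A : F → Set V) (τ κ : F → ℝ) : Prop where
  tree : TreeDist d
  iso : ∀ (g : F) x y, d (g • x) (g • y) = d x y
  conj : ∀ g r, r ∈ RR → g * r * g⁻¹ ∈ RR
  Aconj : ∀ g r x, x ∈ A r → g • x ∈ A (g * r * g⁻¹)
  Ainv : ∀ r, A r⁻¹ = A r
  conv : ∀ r ∈ RR, Conv d (A r)
  ne : ∀ r ∈ RR, (A r).Nonempty
  κconj : ∀ g r, r ∈ RR → κ (g * r * g⁻¹) = κ r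
  κinv : ∀ r ∈ RR, κ r⁻¹ = κ r
  κpos : ∀ r ∈ RR, 0 < κ r
  six : ∀ r ∈ RR, 6 * κ r < τ r
  disp : ∀ r ∈ RR, ∀ e : ℤ, e ≠ 0 → ∀ x, τ r ≤ d x (r ^ e • x)
  sc : ∀ r ∈ RR, ∀ s ∈ RR, s ≠ r → s ≠ r⁻¹ → ∀ x y, x ∈ A r → x ∈ A s → y ∈ A r → y ∈ A s →
    (d x y : ℝ) < κ r

namespace Mill

variable {F V : Type*} [Group F] [MulAction F V] {d : V → V → ℕ} {RR : Set F}
    {A : F → Set V} {τ κ : F → ℝ}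

theorem iso_btw (h : Mill d RR A τ κ) {x z y : V} (hz : Btw d x z y) (g : F) :
    Btw d (g • x) (g • z) (g • y) := by
  unfold Btw at *
  simp only [h.iso]; exact hz

theorem iso_btw' (h : Mill d RR A τ κ) {x z y : V} (g : F) (hz : Btw d (g • x) z (g • y)) :
    Btw d x (g⁻¹ • z) y := by
  have := h.iso_btw hz g⁻¹
  simpa using this

theorem Aconj_inv (h : Mill d RR A τ κ) {g r : F} {x : V} (hx : x ∈ A (g * r * g⁻¹)) :
    g⁻¹ • x ∈ A r := by
  have := h.Aconj g⁻¹ _ x hx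
  have e : g⁻¹ * (g * r * g⁻¹) * g⁻¹⁻¹ = r := by group
  rwa [e] at this

theorem Apow (h : Mill d RR A τ κ) {r : F} (e : ℤ) {x : V} (hx : x ∈ A r) : r ^ e • x ∈ A r := by
  have := h.Aconj (r ^ e) r x hx
  have e : r ^ e * r * (r ^ e)⁻¹ = r := by group
  rwa [e] at this

theorem gate_smul (h : Mill d RR A τ κ) {g r : F} {y π : V} (hg : Gate d (A r) y π) :
    Gate d (A (g * r * g⁻¹)) (g • y) (g • π) := by
  refine ⟨h.Aconj g r π hg.1, fun z hz => ?_⟩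
  have := h.iso_btw (hg.2 _ (h.Aconj_inv hz)) g
  simpa using this

theorem gate_pow (h : Mill d RR A τ κ) {r : F} (e : ℤ) {y π : V} (hg : Gate d (A r) y π) :
    Gate d (A r) (r ^ e • y) (r ^ e • π) := by
  have := h.gate_smul (g := r ^ e) hg
  have e : r ^ e * r * (r ^ e)⁻¹ = r := by group
  rwa [e] at this

/-- State of the windmill. -/
structure Good (d : V → V → ℕ) (RR : Set F) (A : F → Set V) (τ κ : F → ℝ) (v : V)
    (M : Subgroup F) (W : Set V) : Prop where
  mem : v ∈ W
  conv : Conv d W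
  inv : ∀ m ∈ M, ∀ w ∈ W, m • w ∈ W
  small : ∀ s ∈ RR, s ∉ M → ∀ x y, x ∈ A s → x ∈ W → y ∈ A s → y ∈ W → (d x y : ℝ) < 2 * κ s
  green : ∀ m ∈ M, m ≠ 1 → ∃ r ∈ RR, ∃ x y, x ∈ A r ∧ y ∈ A r ∧
    d v (m • v) = d v x + d x y + d y (m • v) ∧ τ r - 3 * κ r < d x y

/-- The new cells touching `W`. -/
def Cells (RR : Set F) (A : F → Set V) (M : Subgroup F) (W : Set V) : Set F :=
  {c | c ∈ RR ∧ c ∉ M ∧ ∃ x, x ∈ A c ∧ x ∈ W}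

/-- The projection of `y` to the axis of `c` is close to `W`. -/
def Near (d : V → V → ℕ) (A : F → Set V) (κ : F → ℝ) (W : Set V) (c : F) (y : V) : Prop :=
  ∃ π, Gate d (A c) y π ∧ ∃ x, x ∈ A c ∧ x ∈ W ∧ (d x π : ℝ) < κ c

/-- The set `W'`. -/
inductive Nxt (d : V → V → ℕ) (RR : Set F) (A : F → Set V) (κ : F → ℝ) (M : Subgroup F)
    (W : Set V) : V → Prop
  | base (w : V) : w ∈ W → Nxt d RR A κ M W w
  | axis (c : F) (x : V) : c ∈ Cells RR A M W → x ∈ A c → Nxt d RR A κ M W x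
  | far (c : F) (e : ℤ) (y : V) : c ∈ Cells RR A M W → e ≠ 0 → Near d A κ W c y →
      Nxt d RR A κ M W y → Nxt d RR A κ M W (c ^ e • y)

/-- Normal forms for the elements of the group generated by `M` and the new cells. -/
inductive NForm (d : V → V → ℕ) (RR : Set F) (A : F → Set V) (κ : F → ℝ) (M : Subgroup F)
    (W : Set V) (v : V) : F → Prop
  | base (m : F) : m ∈ M → NForm d RR A κ M W v m
  | far (c : F) (e : ℤ) (g : F) : c ∈ Cells RR A M W → e ≠ 0 → Near d A κ W c (g • v) →
      NForm d RR A κ M W v g → NForm d RR A κ M W v (c ^ e * g)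

variable {v : V} {M : Subgroup F} {W : Set V}

theorem cells_conj (h : Mill d RR A τ κ) (hG : Good d RR A τ κ v M W) {m c : F} (hm : m ∈ M)
    (hc : c ∈ Cells RR A M W) : m * c * m⁻¹ ∈ Cells RR A M W := by
  obtain ⟨h1, h2, x, h3, h4⟩ := hc
  refine ⟨h.conj m c h1, fun hh => h2 ?_, m • x, h.Aconj m c x h3, hG.inv m hm x h4⟩
  have := M.mul_mem (M.mul_mem (M.inv_mem hm) hh) hm
  have e : m⁻¹ * (m * c * m⁻¹) * m = c := by group
  rwa [e] at this

theorem near_conj (h : Mill d RR A τ κ) (hG : Good d RR A τ κ v M W) {m c : F} (hm : m ∈ M)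
    (hc : c ∈ RR) {y : V} (hn : Near d A κ W c y) : Near d A κ W (m * c * m⁻¹) (m • y) := by
  obtain ⟨π, h1, x, h2, h3, h4⟩ := hn
  refine ⟨m • π, h.gate_smul h1, m • x, h.Aconj _ _ _ h2, hG.inv m hm x h3, ?_⟩
  rw [h.iso, h.κconj m c hc]; exact h4

theorem near_inv (h : Mill d RR A τ κ) {c : F} (hc : c ∈ RR) {y : V} (hn : Near d A κ W c y) :
    Near d A κ W c⁻¹ y := by
  unfold Near at *
  rw [h.Ainv, h.κinv c hc]; exact hn

theorem near_base (h : Mill d RR A τ κ) (hG : Good d RR A τ κ v M W) {c : F}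
    (hc : c ∈ Cells RR A M W) {w : V} (hw : w ∈ W) : Near d A κ W c w := by
  obtain ⟨h1, h2, x, h3, h4⟩ := hc
  obtain ⟨π, hπ⟩ := h.tree.gate_exists (h.conv c h1) ⟨x, h3⟩ w
  refine ⟨π, hπ, π, hπ.1, h.tree.gate_sub hG.conv hπ hw h4 h3, ?_⟩
  rw [h.tree.self]; simpa using h.κpos c h1

/-- Points on the axis of `c` are near to the axis of `s`. -/
theorem near_axis (h : Mill d RR A τ κ) (hG : Good d RR A τ κ v M W) {c s : F}
    (hc : c ∈ Cells RR A M W) (hs : s ∈ Cells RR A M W) (hcs : c ≠ s) (hcs' : c ≠ s⁻¹)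
    {b : V} (hb : b ∈ A c) : Near d A κ W s b := by
  obtain ⟨c1, c2, u, c3, c4⟩ := hc
  obtain ⟨s1, s2, w, s3, s4⟩ := hs
  obtain ⟨π, hπ⟩ := h.tree.gate_exists (h.conv s s1) ⟨w, s3⟩ b
  by_cases hW : π ∈ W
  · exact ⟨π, hπ, π, hπ.1, hW, by rw [h.tree.self]; simpa using h.κpos s s1⟩
  have h1 := hπ.2 w s3
  have hB : π ∈ A c := by
    rcases h.tree.btw_cover h1 u with h2 | h2
    · exact h.conv c c1 b hb u c3 π h2
    · exact absurd (hG.conv u c4 w s4 π h2) hW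
  obtain ⟨m, m1, m2, m3⟩ := h.tree.helly hG.conv (h.conv c c1) (h.conv s s1) c4 c3 s4 s3 hB hπ.1
  exact ⟨π, hπ, m, m3, m1, h.sc s s1 c c1 hcs hcs' m π m3 m2 hπ.1 hB⟩

/-- The gate of a far point is far from `W`. -/
theorem far_gate (h : Mill d RR A τ κ) (hG : Good d RR A τ κ v M W) {c : F} {e : ℤ}
    (hc : c ∈ Cells RR A M W) (he : e ≠ 0) {y : V} (hn : Near d A κ W c y) :
    ∃ b, Gate d (A c) (c ^ e • y) b ∧ ∀ z, z ∈ A c → z ∈ W → τ c - 3 * κ c < d z b := by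
  obtain ⟨π, h1, x, h2, h3, h4⟩ := hn
  refine ⟨c ^ e • π, h.gate_pow e h1, fun z hz hzW => ?_⟩
  have h5 := hG.small c hc.1 hc.2.1 z x hz hzW h2 h3
  have h6 := h.disp c hc.1 e he x
  have h7 : (d x (c ^ e • x) : ℝ) ≤ d x z + d z (c ^ e • π) + d (c ^ e • π) (c ^ e • x) := by
    have a1 := h.tree.tri x z (c ^ e • x)
    have a2 := h.tree.tri z (c ^ e • π) (c ^ e • x)
    exact_mod_cast (by omega : d x (c ^ e • x) ≤ d x z + d z (c ^ e • π) + d (c ^ e • π) (c ^ e • x))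
  rw [h.iso, h.tree.symm π x, h.tree.symm x z] at h7
  linarith

theorem near_far (h : Mill d RR A τ κ) (hG : Good d RR A τ κ v M W) {c s : F} {e : ℤ}
    (hc : c ∈ Cells RR A M W) (hs : s ∈ Cells RR A M W) (hcs : c ≠ s) (hcs' : c ≠ s⁻¹)
    (he : e ≠ 0) {y : V} (hn : Near d A κ W c y) : Near d A κ W s (c ^ e • y) := by
  obtain ⟨b, hb, hfar⟩ := h.far_gate hG hc he hn
  have hs' := near_axis h hG hc hs hcs hcs' hb.1
  obtain ⟨δ, hδ, x, hx1, hx2, hx3⟩ := hs'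
  obtain ⟨c1, c2, u, c3, c4⟩ := id hc
  obtain ⟨s1, s2, w, s3, s4⟩ := id hs
  have hκ := h.κpos c c1
  have hsix := h.six c c1
  have hbD : b ∉ A s := by
    intro hbs
    obtain ⟨m, m1, m2, m3⟩ := h.tree.helly hG.conv (h.conv c c1) (h.conv s s1) c4 c3 s4 s3 hb.1 hbs
    have a1 := hfar m m2 m1
    have hne1 : s ≠ c := fun hh => hcs hh.symm
    have hne2 : s ≠ c⁻¹ := fun hh => hcs' (by rw [hh, inv_inv])
    have a2 := h.sc c c1 s s1 hne1 hne2 m b m2 m3 hb.1 hbs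
    linarith
  obtain ⟨δ', hδ'⟩ := h.tree.gate_exists (h.conv s s1) ⟨w, s3⟩ (c ^ e • y)
  have hEq : δ' = δ := by
    by_contra hne
    have g1 := h.tree.gate_btw hδ' hδ hne
    have g2 : Btw d (c ^ e • y) δ' b := by
      unfold Btw
      have a1 := h.tree.tri δ' δ b
      have a2 := h.tree.tri (c ^ e • y) δ' b
      omega
    have g3 := h.tree.gate_of_btw hb g2
    obtain ⟨ω, hω⟩ := h.tree.gate_exists (h.conv c c1) ⟨u, c3⟩ w
    have hωW : ω ∈ W := h.tree.gate_sub hG.conv hω s4 c4 c3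
    have a1 := hfar ω hω.1 hωW
    have hbω : b ≠ ω := by
      rintro rfl
      rw [h.tree.self] at a1
      push_cast at a1
      linarith
    have g4 := h.tree.gate_btw g3 hω hbω
    apply hbD
    apply h.conv s s1 δ' hδ'.1 w s3 b
    unfold Btw
    have a2 := h.tree.tri b ω w
    have a3 := h.tree.tri δ' b w
    omega
  subst hEq
  exact ⟨δ', hδ', x, hx1, hx2, hx3⟩

theorem nxt_M (h : Mill d RR A τ κ) (hG : Good d RR A τ κ v M W) {m : F} (hm : m ∈ M) {y : V}
    (hy : Nxt d RR A κ M W y) : Nxt d RR A κ M W (m • y) := by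
  induction hy with
  | base w hw => exact Nxt.base _ (hG.inv m hm w hw)
  | axis c x hc hx => exact Nxt.axis _ _ (cells_conj h hG hm hc) (h.Aconj m c x hx)
  | far c e y hc he hn hy ih =>
    have := Nxt.far (m * c * m⁻¹) e (m • y) (cells_conj h hG hm hc) he
      (near_conj h hG hm hc.1 hn) ih
    rw [conj_zpow] at this
    convert this using 1
    simp [mul_smul]

theorem nxt_c (h : Mill d RR A τ κ) (hG : Good d RR A τ κ v M W) {c : F}
    (hc : c ∈ Cells RR A M W) {e : ℤ} (he : e ≠ 0) {y : V}
    (hy : Nxt d RR A κ M W y) : Nxt d RR A κ M W (c ^ e • y) := by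
  cases hy with
  | base w hw => exact Nxt.far c e _ hc he (near_base h hG hc hw) (Nxt.base _ hw)
  | axis s x hs hx =>
    by_cases h1 : s = c
    · subst h1; exact Nxt.axis s _ hs (h.Apow e hx)
    by_cases h2 : s = c⁻¹
    · refine Nxt.axis c _ hc (h.Apow e ?_)
      rw [h2, h.Ainv] at hx; exact hx
    · exact Nxt.far c e _ hc he (near_axis h hG hs hc h1 h2 hx) (Nxt.axis _ _ hs hx)
  | far s f y' hs hf hn hy' =>
    have key : ∀ f' : ℤ, Near d A κ W c y' → Nxt d RR A κ M W (c ^ e • c ^ f' • y') := by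
      intro f' hn'
      rw [← mul_smul, ← zpow_add]
      by_cases h0 : e + f' = 0
      · rw [h0]; simpa using hy'
      · exact Nxt.far c _ _ hc h0 hn' hy'
    by_cases h1 : s = c
    · subst h1; exact key f hn
    by_cases h2 : s = c⁻¹
    · have hn' : Near d A κ W c y' := by
        have := near_inv h hs.1 hn
        rwa [h2, inv_inv] at this
      have := key (-f) hn'
      rw [h2, inv_zpow']; exact this
    · exact Nxt.far c e _ hc he (near_far h hG hs hc h1 h2 hf hn) (Nxt.far s f y' hs hf hn hy')

theorem nform_M (h : Mill d RR A τ κ) (hG : Good d RR A τ κ v M W) {m : F} (hm : m ∈ M) {g : F}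
    (hg : NForm d RR A κ M W v g) : NForm d RR A κ M W v (m * g) := by
  induction hg with
  | base m' hm' => exact NForm.base _ (M.mul_mem hm hm')
  | far c e g hc he hn hg ih =>
    have := NForm.far (m * c * m⁻¹) e (m * g) (cells_conj h hG hm hc) he
      (by rw [mul_smul]; exact near_conj h hG hm hc.1 hn) ih
    rw [conj_zpow] at this
    convert this using 1
    group

theorem nform_c (h : Mill d RR A τ κ) (hG : Good d RR A τ κ v M W) {c : F}
    (hc : c ∈ Cells RR A M W) {e : ℤ} (he : e ≠ 0) {g : F}
    (hg : NForm d RR A κ M W v g) : NForm d RR A κ M W v (c ^ e * g) := by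
  cases hg with
  | base m hm =>
    exact NForm.far c e _ hc he (near_base h hG hc (hG.inv g hm v hG.mem)) (NForm.base _ hm)
  | far s f g' hs hf hn hg' =>
    have key : ∀ f' : ℤ, Near d A κ W c (g' • v) → NForm d RR A κ M W v (c ^ e * (c ^ f' * g')) := by
      intro f' hn'
      rw [← mul_assoc, ← zpow_add]
      by_cases h0 : e + f' = 0
      · rw [h0]; simpa using hg'
      · exact NForm.far c _ _ hc h0 hn' hg'
    by_cases h1 : s = c
    · subst h1; exact key f hn
    by_cases h2 : s = c⁻¹
    · have hn' : Near d A κ W c (g' • v) := by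
        have := near_inv h hs.1 hn
        rwa [h2, inv_inv] at this
      have := key (-f) hn'
      rw [h2, inv_zpow']; exact this
    · refine NForm.far c e _ hc he ?_ (NForm.far s f g' hs hf hn hg')
      rw [mul_smul]
      exact near_far h hG hs hc h1 h2 hf hn

end Mill
end AmalgamFormalization

namespace AmalgamFormalization
namespace Mill

variable {F V : Type*} [Group F] [MulAction F V] {d : V → V → ℕ} {RR : Set F}
    {A : F → Set V} {τ κ : F → ℝ}
variable {v : V} {M : Subgroup F} {W : Set V}

/-- The enlarged group. -/
def NextM (RR : Set F) (A : F → Set V) (M : Subgroup F) (W : Set V) : Subgroup F :=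
  Subgroup.closure ((M : Set F) ∪ Cells RR A M W)

theorem le_nextM : M ≤ NextM RR A M W := fun _ hm => Subgroup.subset_closure (Or.inl hm)

theorem cells_nextM {c : F} (hc : c ∈ Cells RR A M W) : c ∈ NextM RR A M W :=
  Subgroup.subset_closure (Or.inr hc)

theorem nextM_act (h : Mill d RR A τ κ) (hG : Good d RR A τ κ v M W) {g : F}
    (hg : g ∈ NextM RR A M W) :
    ((∀ y, Nxt d RR A κ M W y → Nxt d RR A κ M W (g • y)) ∧
     (∀ y, Nxt d RR A κ M W y → Nxt d RR A κ M W (g⁻¹ • y))) ∧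
    ((∀ y, NForm d RR A κ M W v y → NForm d RR A κ M W v (g * y)) ∧
     (∀ y, NForm d RR A κ M W v y → NForm d RR A κ M W v (g⁻¹ * y))) := by
  unfold NextM at hg
  induction hg using Subgroup.closure_induction with
  | mem x hx =>
    rcases hx with hx | hx
    · exact ⟨⟨fun y hy => nxt_M h hG hx hy, fun y hy => nxt_M h hG (M.inv_mem hx) hy⟩,
        fun y hy => nform_M h hG hx hy, fun y hy => nform_M h hG (M.inv_mem hx) hy⟩
    · have e1 : x = x ^ (1 : ℤ) := by simp
      have e2 : x⁻¹ = x ^ (-1 : ℤ) := by simp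
      refine ⟨⟨fun y hy => ?_, fun y hy => ?_⟩, fun y hy => ?_, fun y hy => ?_⟩
      · rw [e1]; exact nxt_c h hG hx one_ne_zero hy
      · rw [e2]; exact nxt_c h hG hx (by norm_num) hy
      · rw [e1]; exact nform_c h hG hx one_ne_zero hy
      · rw [e2]; exact nform_c h hG hx (by norm_num) hy
  | one => simp
  | mul x y _ _ hx hy =>
    obtain ⟨⟨a1, a2⟩, a3, a4⟩ := hx
    obtain ⟨⟨b1, b2⟩, b3, b4⟩ := hy
    refine ⟨⟨fun z hz => ?_, fun z hz => ?_⟩, fun z hz => ?_, fun z hz => ?_⟩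
    · rw [mul_smul]; exact a1 _ (b1 _ hz)
    · rw [mul_inv_rev, mul_smul]; exact b2 _ (a2 _ hz)
    · rw [mul_assoc]; exact a3 _ (b3 _ hz)
    · rw [mul_inv_rev, mul_assoc]; exact b4 _ (a4 _ hz)
  | inv x _ hx =>
    obtain ⟨⟨a1, a2⟩, a3, a4⟩ := hx
    exact ⟨⟨a2, by simpa using a1⟩, a4, by simpa using a3⟩

theorem nxt_star (h : Mill d RR A τ κ) (hG : Good d RR A τ κ v M W) {y : V}
    (hy : Nxt d RR A κ M W y) : ∀ w ∈ W, ∀ z, Btw d w z y → Nxt d RR A κ M W z := by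
  induction hy with
  | base w' hw' => exact fun w hw z hz => Nxt.base _ (hG.conv w hw w' hw' z hz)
  | axis c x hc hx =>
    intro w hw z hz
    obtain ⟨c1, c2, u, c3, c4⟩ := id hc
    rcases h.tree.btw_cover hz u with h1 | h1
    · exact Nxt.base _ (hG.conv w hw u c4 z h1)
    · exact Nxt.axis c z hc (h.conv c c1 u c3 x hx z h1)
  | far c e y hc he hn hy ih =>
    intro w hw z hz
    obtain ⟨c1, c2, u, c3, c4⟩ := id hc
    rcases h.tree.btw_cover hz u with h1 | h1
    · exact Nxt.base _ (hG.conv w hw u c4 z h1)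
    rcases h.tree.btw_cover h1 (c ^ e • u) with h2 | h2
    · exact Nxt.axis c z hc (h.conv c c1 u c3 _ (h.Apow e c3) z h2)
    have h3 := ih u c4 _ (h.iso_btw' (c ^ e) h2)
    have := nxt_c h hG hc he h3
    simpa using this

theorem nxt_conv (h : Mill d RR A τ κ) (hG : Good d RR A τ κ v M W) :
    Conv d {y | Nxt d RR A κ M W y} := by
  intro x hx y hy z hz
  rcases h.tree.btw_cover hz v with h1 | h1
  · exact nxt_star h hG hx v hG.mem z (h.tree.btw_symm h1)
  · exact nxt_star h hG hy v hG.mem z h1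

theorem nxt_lift {y : V} (hy : Nxt d RR A κ M W y) :
    ∃ g ∈ NextM RR A M W, g • y ∈ W ∨ ∃ c ∈ Cells RR A M W, g • y ∈ A c := by
  induction hy with
  | base w hw => exact ⟨1, Subgroup.one_mem _, by simpa using Or.inl hw⟩
  | axis c x hc hx => exact ⟨1, Subgroup.one_mem _, Or.inr ⟨c, hc, by simpa using hx⟩⟩
  | far c e y hc he hn hy ih =>
    obtain ⟨g, hg, hh⟩ := ih
    refine ⟨g * (c ^ e)⁻¹, Subgroup.mul_mem _ hg
      (Subgroup.inv_mem _ (Subgroup.zpow_mem _ (cells_nextM hc) e)), ?_⟩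
    rw [mul_smul, inv_smul_smul]
    exact hh

theorem noW {s : F} (hs : s ∈ RR) (hs' : s ∉ NextM RR A M W)
    {z : V} (hz : z ∈ A s) : z ∉ W := by
  intro hw
  by_cases hm : s ∈ M
  · exact hs' (le_nextM hm)
  · exact hs' (cells_nextM ⟨hs, hm, z, hz, hw⟩)

theorem conj_notMem {K : Subgroup F} {g s : F} (hg : g ∈ K) (hs : s ∉ K) : g * s * g⁻¹ ∉ K := by
  intro hh
  apply hs
  have := K.mul_mem (K.mul_mem (K.inv_mem hg) hh) hg
  have e : g⁻¹ * (g * s * g⁻¹) * g = s := by group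
  rwa [e] at this

theorem small_aux (h : Mill d RR A τ κ) (hG : Good d RR A τ κ v M W) {b : V}
    (hb : Nxt d RR A κ M W b) : ∀ s ∈ RR, s ∉ NextM RR A M W → ∀ c1 ∈ Cells RR A M W,
      ∀ a, a ∈ A c1 → a ∈ A s → b ∈ A s → (d a b : ℝ) < 2 * κ s := by
  have nocell : ∀ s, s ∉ NextM RR A M W → ∀ c ∈ Cells RR A M W, c ≠ s ∧ c ≠ s⁻¹ := by
    intro s hs c hc
    refine ⟨fun hh => hs (hh ▸ cells_nextM hc), fun hh => hs ?_⟩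
    have := Subgroup.inv_mem _ (cells_nextM (W := W) hc)
    rwa [hh, inv_inv] at this
  induction hb with
  | base w hw => exact fun s hs hs' _ _ _ _ _ hbs => absurd hw (noW hs hs' hbs)
  | axis c2 b hc2 hb =>
    intro s hs hs' c1 hc1 a ha has hbs
    have n1 := nocell s hs' c1 hc1
    have n2 := nocell s hs' c2 hc2
    obtain ⟨p1, p2, u1, p3, p4⟩ := hc1
    obtain ⟨q1, q2, u2, q3, q4⟩ := hc2
    obtain ⟨α, hα⟩ := h.tree.gate_exists hG.conv ⟨v, hG.mem⟩ a
    obtain ⟨β, hβ⟩ := h.tree.gate_exists hG.conv ⟨v, hG.mem⟩ b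
    have hαβ : α = β := by
      by_contra hne
      have g := h.tree.gate_btw hα hβ hne
      have : α ∈ A s := by
        apply h.conv s hs a has b hbs
        unfold Btw
        have a1 := h.tree.tri α β b
        have a2 := h.tree.tri a α b
        omega
      exact noW hs hs' this hα.1
    subst hαβ
    have hα1 : α ∈ A c1 := h.tree.gate_sub (h.conv c1 p1) hα ha p3 p4
    have hα2 : α ∈ A c2 := h.tree.gate_sub (h.conv c2 q1) hβ hb q3 q4
    obtain ⟨m, m1, m2, m3⟩ := h.tree.med a b α
    have ms : m ∈ A s := h.conv s hs a has b hbs m m1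
    have mc1 : m ∈ A c1 := h.conv c1 p1 a ha α hα1 m m2
    have mc2 : m ∈ A c2 := h.conv c2 q1 b hb α hα2 m m3
    have l1 := h.sc s hs c1 p1 n1.1 n1.2 a m has ha ms mc1
    have l2 := h.sc s hs c2 q1 n2.1 n2.2 m b ms mc2 hbs hb
    rw [← m1]; push_cast; linarith
  | far c e y hc he hn hy ih =>
    intro s hs hs' c1 hc1 a ha has hbs
    have n := nocell s hs' c hc
    have key : a ∈ A c → (d a (c ^ e • y) : ℝ) < 2 * κ s := by
      intro hac
      have hce : c ^ (-e) ∈ NextM RR A M W := Subgroup.zpow_mem _ (cells_nextM hc) _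
      have := ih (c ^ (-e) * s * (c ^ (-e))⁻¹) (h.conj _ _ hs) (conj_notMem hce hs') c hc
        (c ^ (-e) • a) (h.Apow _ hac) (h.Aconj _ _ _ has) (by
          have := h.Aconj (c ^ (-e)) _ _ hbs
          rwa [← mul_smul, ← zpow_add, neg_add_cancel, zpow_zero, one_smul] at this)
      rw [h.κconj _ _ hs] at this
      have e2 := h.iso (c ^ (-e)) a (c ^ e • y)
      rw [← mul_smul, ← zpow_add, neg_add_cancel, zpow_zero, one_smul] at e2
      rwa [e2] at this
    by_cases h1 : c1 = c
    · subst h1; exact key ha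
    by_cases h2 : c1 = c⁻¹
    · rw [h2, h.Ainv] at ha; exact key ha
    exfalso
    obtain ⟨α, hα, x, hx1, hx2, hx3⟩ := near_axis h hG hc1 hc h1 h2 ha
    obtain ⟨β, hβ, hfar⟩ := h.far_gate hG hc he hn
    have f1 := hfar x hx1 hx2
    have t1 := h.tree.tri x α β
    have t2 : (d x β : ℝ) ≤ d x α + d α β := by exact_mod_cast t1
    have hsix := h.six c hc.1
    have hκ := h.κpos c hc.1
    have hne : α ≠ β := by
      rintro rfl
      linarith
    have g := h.tree.gate_btw hα hβ hne
    have t3 := h.tree.tri α β (c ^ e • y)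
    have t4 := h.tree.tri a α (c ^ e • y)
    have t5 := h.tree.tri a α β
    have t6 := h.tree.tri a β (c ^ e • y)
    have i1 : α ∈ A s := h.conv s hs a has _ hbs α (by unfold Btw; omega)
    have i2 : β ∈ A s := h.conv s hs a has _ hbs β (by unfold Btw; omega)
    have := h.sc c hc.1 s hs (fun hh => n.1 hh.symm) (fun hh => n.2 (by rw [hh, inv_inv])) α β
      hα.1 i1 hβ.1 i2
    linarith

theorem good_next (h : Mill d RR A τ κ) (hG : Good d RR A τ κ v M W) :
    Good d RR A τ κ v (NextM RR A M W) {y | Nxt d RR A κ M W y} where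
  mem := Nxt.base _ hG.mem
  conv := nxt_conv h hG
  inv := fun m hm w hw => (nextM_act h hG hm).1.1 w hw
  small := by
    intro s hs hs' x y hxs hx hys hy
    obtain ⟨g, hg, hh⟩ := nxt_lift hx
    have hs2 := conj_notMem hg hs'
    have hsR := h.conj g s hs
    rcases hh with hh | ⟨c, hc, hh⟩
    · exact absurd hh (noW hsR hs2 (h.Aconj _ _ _ hxs))
    · have := small_aux h hG ((nextM_act h hG hg).1.1 y hy) _ hsR hs2 c hc (g • x) hh
        (h.Aconj _ _ _ hxs) (h.Aconj _ _ _ hys)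
      rwa [h.iso, h.κconj _ _ hs] at this
  green := by
    intro m hm hm1
    have hnf : NForm d RR A κ M W v m := by
      have := (nextM_act h hG hm).2.1 1 (NForm.base 1 M.one_mem)
      simpa using this
    cases hnf with
    | base m hm => exact hG.green _ hm hm1
    | far c e g hc he hn hg =>
      obtain ⟨β, hβ, hfar⟩ := h.far_gate hG hc he hn
      obtain ⟨α, hα, x, hx1, hx2, hx3⟩ := near_base h hG hc hG.mem
      have hαW : α ∈ W := h.tree.gate_sub hG.conv hα hG.mem hx2 hx1
      have f := hfar α hα.1 hαW
      have hsix := h.six c hc.1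
      have hκ := h.κpos c hc.1
      have hne : α ≠ β := by
        rintro rfl
        rw [h.tree.self] at f; push_cast at f
        linarith
      refine ⟨c, hc.1, α, β, hα.1, hβ.1, ?_, f⟩
      rw [mul_smul]
      exact h.tree.gate_btw hα hβ hne

theorem good_thick (h : Mill d RR A τ κ) (hG : Good d RR A τ κ v M W)
    (hsat : ∀ s ∈ RR, s ∉ M → ∀ x ∈ A s, x ∉ W) :
    Good d RR A τ κ v M {y | ∃ w ∈ W, d y w ≤ 1} where
  mem := ⟨v, hG.mem, by rw [h.tree.self]; omega⟩
  conv := by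
    rintro x ⟨w, hw, h1⟩ y ⟨w', hw', h2⟩ z hz
    have edge : ∀ x w z, w ∈ W → d x w ≤ 1 → Btw d x z w → ∃ w ∈ W, d z w ≤ 1 := by
      intro x w z hw h1 h2
      refine ⟨w, hw, ?_⟩
      unfold Btw at h2; omega
    rcases h.tree.btw_cover hz w with h3 | h3
    · exact edge x w z hw h1 h3
    rcases h.tree.btw_cover h3 w' with h4 | h4
    · exact ⟨z, hG.conv w hw w' hw' z h4, by rw [h.tree.self]; omega⟩
    · exact edge y w' z hw' h2 (h.tree.btw_symm h4)
  inv := by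
    rintro m hm x ⟨w, hw, h1⟩
    exact ⟨m • w, hG.inv m hm w hw, by rw [h.iso]; exact h1⟩
  small := by
    rintro s hs hsM x y hxs ⟨w, hw, hxw⟩ hys ⟨w', hw', hyw⟩
    have hκ := h.κpos s hs
    suffices hxy : x = y by
      subst hxy; rw [h.tree.self]; push_cast; linarith
    obtain ⟨α, hα⟩ := h.tree.gate_exists hG.conv ⟨v, hG.mem⟩ x
    obtain ⟨β, hβ⟩ := h.tree.gate_exists hG.conv ⟨v, hG.mem⟩ y
    have hαβ : α = β := by
      by_contra hne
      have g := h.tree.gate_btw hα hβ hne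
      have : α ∈ A s := by
        apply h.conv s hs x hxs y hys
        unfold Btw
        have a1 := h.tree.tri α β y
        have a2 := h.tree.tri x α y
        omega
      exact hsat s hs hsM α this hα.1
    subst hαβ
    obtain ⟨m, m1, m2, m3⟩ := h.tree.med x y α
    have ms : m ∈ A s := h.conv s hs x hxs y hys m m1
    have hmα : m ≠ α := fun hh => hsat s hs hsM m ms (hh ▸ hα.1)
    have hd : d m α ≠ 0 := fun hh => hmα (h.tree.eq _ _ hh)
    have g1 := hα.2 w hw
    have g2 := hβ.2 w' hw'
    unfold Btw at g1 g2
    have e1 : x = m := h.tree.eq _ _ (by omega)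
    have e2 : y = m := h.tree.eq _ _ (by omega)
    rw [e1, e2]
  green := hG.green

theorem good_start (h : Mill d RR A τ κ) (v : V) : Good d RR A τ κ v ⊥ {v} where
  mem := rfl
  conv := by
    rintro x rfl y rfl z hz
    unfold Btw at hz
    rw [h.tree.self] at hz
    exact (h.tree.eq _ _ (by omega)).symm
  inv := by
    rintro m hm w rfl
    rw [Subgroup.mem_bot] at hm
    simp [hm]
  small := by
    rintro s hs _ x y _ rfl _ rfl
    have hκ := h.κpos s hs
    rw [h.tree.self]; push_cast; linarith
  green := fun m hm hm1 => absurd (Subgroup.mem_bot.1 hm) hm1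

theorem good_chain (C : Set (Subgroup F × Set V)) (hC : IsChain (· ≤ ·) C)
    (hne : C.Nonempty) (hgood : ∀ p ∈ C, Good d RR A τ κ v p.1 p.2) :
    Good d RR A τ κ v (sSup (Prod.fst '' C)) (⋃ p ∈ C, p.2) := by
  have hdir : DirectedOn (· ≤ ·) (Prod.fst '' C) := by
    rintro _ ⟨p, hp, rfl⟩ _ ⟨q, hq, rfl⟩
    rcases hC.total hp hq with hh | hh
    · exact ⟨q.1, ⟨q, hq, rfl⟩, hh.1, le_rfl⟩
    · exact ⟨p.1, ⟨p, hp, rfl⟩, le_rfl, hh.1⟩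
  have hmem : ∀ m, m ∈ sSup (Prod.fst '' C) ↔ ∃ p ∈ C, m ∈ p.1 := by
    intro m
    rw [Subgroup.mem_sSup_of_directedOn (hne.image _) hdir]
    simp
  have two : ∀ p ∈ C, ∀ q ∈ C, ∃ r ∈ C, p ≤ r ∧ q ≤ r := by
    intro p hp q hq
    rcases hC.total hp hq with hh | hh
    · exact ⟨q, hq, hh, le_rfl⟩
    · exact ⟨p, hp, le_rfl, hh⟩
  have hW : ∀ x, x ∈ (⋃ p ∈ C, p.2) ↔ ∃ p ∈ C, x ∈ p.2 := by
    intro x; simp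
  constructor
  · obtain ⟨p, hp⟩ := hne
    exact (hW v).2 ⟨p, hp, (hgood p hp).mem⟩
  · intro x hx y hy z hz
    obtain ⟨p, hp, hx⟩ := (hW x).1 hx
    obtain ⟨q, hq, hy⟩ := (hW y).1 hy
    obtain ⟨r, hr, h1, h2⟩ := two p hp q hq
    exact (hW z).2 ⟨r, hr, (hgood r hr).conv x (h1.2 hx) y (h2.2 hy) z hz⟩
  · intro m hm x hx
    obtain ⟨p, hp, hm⟩ := (hmem m).1 hm
    obtain ⟨q, hq, hx⟩ := (hW x).1 hx
    obtain ⟨r, hr, h1, h2⟩ := two p hp q hq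
    exact (hW _).2 ⟨r, hr, (hgood r hr).inv m (h1.1 hm) x (h2.2 hx)⟩
  · intro s hs hsM x y hxs hx hys hy
    obtain ⟨p, hp, hx⟩ := (hW x).1 hx
    obtain ⟨q, hq, hy⟩ := (hW y).1 hy
    obtain ⟨r, hr, h1, h2⟩ := two p hp q hq
    exact (hgood r hr).small s hs (fun hh => hsM ((hmem s).2 ⟨r, hr, hh⟩)) x y hxs (h1.2 hx)
      hys (h2.2 hy)
  · intro m hm hm1
    obtain ⟨p, hp, hm⟩ := (hmem m).1 hm
    exact (hgood p hp).green m hm hm1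

/-- Greendlinger's lemma over a tree. -/
theorem greendlinger (h : Mill d RR A τ κ) (v : V) (m : F) (hm : m ∈ Subgroup.closure RR)
    (hm1 : m ≠ 1) : ∃ r ∈ RR, ∃ x y, x ∈ A r ∧ y ∈ A r ∧
      d v (m • v) = d v x + d x y + d y (m • v) ∧ τ r - 3 * κ r < d x y := by
  obtain ⟨⟨M, W⟩, -, hmax⟩ := zorn_le_nonempty₀
    {p : Subgroup F × Set V | Good d RR A τ κ v p.1 p.2}
    (fun C hCs hC y hy => ⟨(sSup (Prod.fst '' C), ⋃ p ∈ C, p.2),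
      good_chain C hC ⟨y, hy⟩ (fun p hp => hCs hp), fun p hp =>
        ⟨le_sSup ⟨p, hp, rfl⟩, Set.subset_biUnion_of_mem (u := fun p : Subgroup F × Set V => p.2) hp⟩⟩)
    (⊥, {v}) (good_start h v)
  have hG : Good d RR A τ κ v M W := hmax.1
  have hsat : ∀ s ∈ RR, s ∉ M → ∀ x ∈ A s, x ∉ W := by
    intro s hs hsM x hx hxW
    have h1 : (M, W) ≤ (NextM RR A M W, {y | Nxt d RR A κ M W y}) :=
      ⟨le_nextM, fun w hw => Nxt.base _ hw⟩
    have h2 := hmax.2 (good_next h hG) h1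
    exact hsM (h2.1 (cells_nextM ⟨hs, hsM, x, hx, hxW⟩))
  have hfull : ∀ x, x ∈ W := by
    intro x
    have h1 : (M, W) ≤ (M, {y | ∃ w ∈ W, d y w ≤ 1}) :=
      ⟨le_rfl, fun w hw => ⟨w, hw, by rw [h.tree.self]; omega⟩⟩
    have h2 := hmax.2 (good_thick h hG hsat) h1
    by_contra hx
    obtain ⟨π, hπ⟩ := h.tree.gate_exists hG.conv ⟨v, hG.mem⟩ x
    have hne : π ≠ x := fun hh => hx (hh ▸ hπ.1)
    obtain ⟨z, hz1, hz2⟩ := h.tree.step π x hne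
    have hzW : z ∈ W := h2.2 ⟨π, hπ.1, by rw [h.tree.symm]; omega⟩
    have h3 := hπ.2 z hzW
    unfold Btw at h3
    have := h.tree.symm x π
    have := h.tree.symm x z
    omega
  have hRM : Subgroup.closure RR ≤ M := by
    rw [Subgroup.closure_le]
    intro s hs
    by_contra hsM
    obtain ⟨x, hx⟩ := h.ne s hs
    exact hsat s hs hsM x hx (hfull x)
  exact hG.green m (hRM hm) hm1

end Mill
end AmalgamFormalization

namespace AmalgamFormalization

/-! ### Trees as graphs -/

section TreeGraph

variable {V : Type*} {Γ : SimpleGraph V}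

theorem closer_unique (hT : Γ.IsTree) {c x y z : V} (hx : Γ.Adj x z) (hy : Γ.Adj y z)
    (h1 : Γ.dist c z = Γ.dist c x + 1) (h2 : Γ.dist c z = Γ.dist c y + 1) : x = y := by
  obtain ⟨p, hp⟩ := hT.connected.exists_walk_length_eq_dist c x
  obtain ⟨q, hq⟩ := hT.connected.exists_walk_length_eq_dist c y
  have hp' : (p.concat hx).IsPath := by
    apply SimpleGraph.Walk.isPath_of_length_eq_dist
    rw [SimpleGraph.Walk.length_concat]; omega
  have hq' : (q.concat hy).IsPath := by
    apply SimpleGraph.Walk.isPath_of_length_eq_dist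
    rw [SimpleGraph.Walk.length_concat]; omega
  have h3 := (hT.isAcyclic.subsingleton_path c z).elim ⟨_, hp'⟩ ⟨_, hq'⟩
  have h4 : p.concat hx = q.concat hy := congrArg Subtype.val h3
  have h5 := congrArg SimpleGraph.Walk.penultimate h4
  simpa using h5

theorem step_exists (hT : Γ.IsTree) {a b : V} (hab : a ≠ b) :
    ∃ x, Γ.Adj a x ∧ Γ.dist a b = Γ.dist x b + 1 := by
  obtain ⟨p, hp⟩ := hT.connected.exists_walk_length_eq_dist a b
  cases p with
  | nil => exact absurd rfl hab
  | cons h q =>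
    rename_i x
    refine ⟨x, h, ?_⟩
    have h1 := SimpleGraph.dist_le q
    have h2 := hT.connected.dist_triangle (u := a) (v := x) (w := b)
    rw [SimpleGraph.dist_eq_one_iff_adj.2 h] at h2
    rw [SimpleGraph.Walk.length_cons] at hp
    omega

theorem adj_cases (hT : Γ.IsTree) (c : V) {x y : V} (h : Γ.Adj x y) :
    Γ.dist x c = Γ.dist y c + 1 ∨ Γ.dist y c = Γ.dist x c + 1 := by
  rw [SimpleGraph.dist_comm (u := x), SimpleGraph.dist_comm (u := y)]
  exact hT.dist_eq_dist_add_one_of_adj c h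

theorem away (hT : Γ.IsTree) (b c : V) : ∀ (n : ℕ) (a a' : V), Γ.dist a' b = n → Γ.Adj a a' →
    Γ.dist a' c = Γ.dist a c + 1 → Γ.dist a b = Γ.dist a' b + 1 →
    Γ.dist b c = Γ.dist a b + Γ.dist a c := by
  intro n
  induction n with
  | zero =>
    intro a a' h1 h2 h3 h4
    have := hT.connected.dist_eq_zero_iff.1 h1
    subst this
    omega
  | succ n ih =>
    intro a a' h1 h2 h3 h4
    have hne : a' ≠ b := by
      rintro rfl
      simp at h1
    obtain ⟨a'', h5, h6⟩ := step_exists hT hne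
    rcases adj_cases hT c h5 with h7 | h7
    · exfalso
      have := closer_unique hT (c := c) h2 h5.symm
        (by rw [SimpleGraph.dist_comm, h3, SimpleGraph.dist_comm])
        (by rw [SimpleGraph.dist_comm, h7, SimpleGraph.dist_comm])
      subst this
      omega
    · have := ih a' a'' (by omega) h5 h7 h6
      omega

theorem treeDist (hT : Γ.IsTree) : TreeDist Γ.dist where
  self x := SimpleGraph.dist_self
  eq x y h := hT.connected.dist_eq_zero_iff.1 h
  symm x y := SimpleGraph.dist_comm
  tri x y z := hT.connected.dist_triangle
  step a b hab := by
    obtain ⟨x, h1, h2⟩ := step_exists hT hab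
    have := SimpleGraph.dist_eq_one_iff_adj.2 h1
    exact ⟨x, this, by omega⟩
  med := by
    suffices H : ∀ (n : ℕ) (a b c : V), Γ.dist a b = n → ∃ m, Γ.dist a m + Γ.dist m b = Γ.dist a b ∧
        Γ.dist a m + Γ.dist m c = Γ.dist a c ∧ Γ.dist b m + Γ.dist m c = Γ.dist b c from
      fun a b c => H _ a b c rfl
    intro n
    induction n with
    | zero =>
      intro a b c h
      have := hT.connected.dist_eq_zero_iff.1 h
      subst this
      exact ⟨a, by simp⟩
    | succ n ih =>
      intro a b c h
      have hne : a ≠ b := by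
        rintro rfl
        simp at h
      obtain ⟨a', h1, h2⟩ := step_exists hT hne
      have h1' := SimpleGraph.dist_eq_one_iff_adj.2 h1
      rcases adj_cases hT c h1 with h7 | h7
      · obtain ⟨m, e1, e2, e3⟩ := ih a' b c (by omega)
        have t1 := hT.connected.dist_triangle (u := a) (v := a') (w := m)
        have t2 := hT.connected.dist_triangle (u := a) (v := m) (w := b)
        have t3 := hT.connected.dist_triangle (u := a) (v := m) (w := c)
        exact ⟨m, by omega, by omega, e3⟩
      · have := away hT b c _ a a' rfl h1 h7 h2
        have := SimpleGraph.dist_comm (G := Γ) (u := a) (v := b)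
        exact ⟨a, by simp, by simp, by omega⟩
  fp := by
    suffices H : ∀ (n : ℕ) (a b c e : V), Γ.dist a b = n → Γ.dist a b + Γ.dist c e ≤
        max (Γ.dist a c + Γ.dist b e) (Γ.dist a e + Γ.dist b c) from
      fun a b c e => H _ a b c e rfl
    intro n
    induction n with
    | zero =>
      intro a b c e h
      have := hT.connected.dist_eq_zero_iff.1 h
      subst this
      have t1 := hT.connected.dist_triangle (u := c) (v := a) (w := e)
      have := SimpleGraph.dist_comm (G := Γ) (u := c) (v := a)
      rw [le_max_iff]; left; omega
    | succ n ih =>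
      intro a b c e h
      have hne : a ≠ b := by
        rintro rfl
        simp at h
      obtain ⟨a', h1, h2⟩ := step_exists hT hne
      have t1 := hT.connected.dist_triangle (u := c) (v := a) (w := e)
      have t2 := SimpleGraph.dist_comm (G := Γ) (u := c) (v := a)
      rcases adj_cases hT c h1 with h7 | h7
      · rcases adj_cases hT e h1 with h8 | h8
        · have := ih a' b c e (by omega)
          rw [le_max_iff] at *
          omega
        · have := away hT b e _ a a' rfl h1 h8 h2
          rw [le_max_iff]; omega
      · have := away hT b c _ a a' rfl h1 h7 h2
        rw [le_max_iff]; omega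

theorem nb_dist (hT : Γ.IsTree) (f : ℕ → V) (n : ℕ) (h1 : ∀ k < n, Γ.Adj (f k) (f (k + 1)))
    (h2 : ∀ k, k + 2 ≤ n → f k ≠ f (k + 2)) : Γ.dist (f 0) (f n) = n := by
  suffices H : ∀ k, k + 1 ≤ n → Γ.dist (f 0) (f k) = k ∧ Γ.dist (f 0) (f (k + 1)) = k + 1 by
    rcases n with _ | n
    · simp
    · exact (H n le_rfl).2
  intro k
  induction k with
  | zero =>
    intro hk
    exact ⟨by simp, SimpleGraph.dist_eq_one_iff_adj.2 (h1 0 (by omega))⟩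
  | succ k ih =>
    intro hk
    obtain ⟨e1, e2⟩ := ih (by omega)
    refine ⟨e2, ?_⟩
    rcases hT.dist_eq_dist_add_one_of_adj (f 0) (h1 (k + 1) (by omega)) with h | h
    · exfalso
      exact h2 k (by omega) (closer_unique hT (c := f 0) (h1 k (by omega))
        (h1 (k + 1) (by omega)).symm (by omega) h)
    · omega

theorem isTree_of_nb (hc : Γ.Connected)
    (H : ∀ (f : ℕ → V) (n : ℕ), 3 ≤ n → (∀ k < n, Γ.Adj (f k) (f (k + 1))) →
      (∀ k, k + 2 ≤ n → f k ≠ f (k + 2)) → f 0 ≠ f n) : Γ.IsTree := by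
  refine ⟨hc, ?_⟩
  intro v c hcyc
  refine H c.getVert c.length hcyc.three_le_length (fun k hk => c.adj_getVert_succ hk) ?_ ?_
  · intro k hk he
    have hl := hcyc.three_le_length
    rcases Nat.eq_zero_or_pos k with rfl | hk0
    · have h0 : c.getVert 0 = c.getVert c.length := by simp
      rw [h0] at he
      have := hcyc.getVert_injOn (x₁ := c.length) (by simp; omega) (x₂ := 0 + 2) (by simp; omega) he
      omega
    · have := hcyc.getVert_injOn (x₁ := k) (by simp; omega) (x₂ := k + 2) (by simp; omega) he
      omega
  · simp

end TreeGraph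

end AmalgamFormalization

namespace AmalgamFormalization

/-! ### The Bass-Serre tree -/

variable {F : Type u} [Group F]

/-- The two factors, indexed by booleans. -/
def Fac (L G : Subgroup F) (b : Bool) : Subgroup F := bif b then L else G

/-- Vertices of the Bass-Serre tree. -/
abbrev BV (L G : Subgroup F) := Σ b : Bool, F ⧸ Fac L G b

/-- The vertex given by a coset. -/
def vert (L G : Subgroup F) (b : Bool) (g : F) : BV L G := ⟨b, (g : F ⧸ Fac L G b)⟩

theorem vert_eq {L G : Subgroup F} {b b' : Bool} {g g' : F} :
    vert L G b g = vert L G b' g' ↔ b = b' ∧ g⁻¹ * g' ∈ Fac L G b := by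
  constructor
  · intro h
    have h1 : b = b' := congrArg Sigma.fst h
    subst h1
    refine ⟨rfl, ?_⟩
    unfold vert at h
    rw [Sigma.mk.injEq] at h
    exact QuotientGroup.eq.1 (eq_of_heq h.2)
  · rintro ⟨rfl, h⟩
    unfold vert
    rw [QuotientGroup.eq.2 h]

theorem smul_vert {L G : Subgroup F} {b : Bool} (h g : F) :
    h • vert L G b g = vert L G b (h * g) := rfl

theorem vert_surj {L G : Subgroup F} (x : BV L G) : ∃ g, x = vert L G x.1 g := by
  obtain ⟨b, q⟩ := x
  obtain ⟨g, rfl⟩ := QuotientGroup.mk_surjective q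
  exact ⟨g, rfl⟩

/-- The Bass-Serre graph. -/
def BS (L G : Subgroup F) : SimpleGraph (BV L G) where
  Adj x y := ∃ g b, x = vert L G b g ∧ y = vert L G (!b) g
  symm := ⟨fun x y ⟨g, b, h1, h2⟩ => ⟨g, !b, h2, by simpa using h1⟩⟩
  loopless := ⟨fun x ⟨g, b, h1, h2⟩ => by
    have := (vert_eq.1 (h1.symm.trans h2)).1
    cases b <;> simp at this⟩

/-- Distance in the Bass-Serre tree. -/
noncomputable def bd (L G : Subgroup F) : BV L G → BV L G → ℕ := (BS L G).dist

theorem adj_smul {L G : Subgroup F} (h : F) {x y : BV L G} (hxy : (BS L G).Adj x y) :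
    (BS L G).Adj (h • x) (h • y) := by
  obtain ⟨g, b, rfl, rfl⟩ := hxy
  exact ⟨h * g, b, rfl, rfl⟩

theorem adj_fst {L G : Subgroup F} {x y : BV L G} (hxy : (BS L G).Adj x y) : y.1 = !x.1 := by
  obtain ⟨g, b, rfl, rfl⟩ := hxy
  rfl

theorem adj_vert {L G : Subgroup F} (b : Bool) (g : F) :
    (BS L G).Adj (vert L G b g) (vert L G (!b) g) := ⟨g, b, rfl, rfl⟩

theorem mem_inf_fac {L G : Subgroup F} (b : Bool) {h : F} :
    h ∈ L ⊓ G ↔ h ∈ Fac L G b ∧ h ∈ Fac L G (!b) := by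
  cases b <;> simp [Fac, and_comm]

theorem smul_reach {L G : Subgroup F} (h : F) {x y : BV L G} (hxy : (BS L G).Reachable x y) :
    (BS L G).Reachable (h • x) (h • y) := by
  obtain ⟨p⟩ := hxy
  induction p with
  | nil => exact SimpleGraph.Reachable.refl _
  | cons e _ ih => exact (adj_smul h e).reachable.trans ih

theorem bs_connected {L G : Subgroup F} (hF : IsAmalgam L G) : (BS L G).Connected := by
  have key : ∀ g : F, (BS L G).Reachable (vert L G true 1) (vert L G true g) := by
    let S : Subgroup F :=
      { carrier := {g | (BS L G).Reachable (vert L G true 1) (vert L G true g)}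
        one_mem' := SimpleGraph.Reachable.refl _
        mul_mem' := by
          intro a b ha hb
          have := smul_reach a hb
          rw [smul_vert, smul_vert, mul_one] at this
          exact SimpleGraph.Reachable.trans ha this
        inv_mem' := by
          intro a ha
          have := smul_reach a⁻¹ ha
          rw [smul_vert, smul_vert, mul_one, inv_mul_cancel] at this
          exact this.symm }
    have hL : L ≤ S := by
      intro g hg
      have : vert L G true 1 = vert L G true g := vert_eq.2 ⟨rfl, by simpa [Fac] using hg⟩
      change (BS L G).Reachable (vert L G true 1) (vert L G true g)
      rw [← this]
    have hG : G ≤ S := by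
      intro g hg
      have : vert L G false 1 = vert L G false g := vert_eq.2 ⟨rfl, by simpa [Fac] using hg⟩
      change (BS L G).Reachable (vert L G true 1) (vert L G true g)
      refine (adj_vert true 1).reachable.trans ?_
      have h2 := (adj_vert (L := L) (G := G) true g).reachable
      simp only [Bool.not_true] at h2 ⊢
      rw [this]
      exact h2.symm
    have : (⊤ : Subgroup F) ≤ S := hF.1 ▸ sup_le hL hG
    exact fun g => this (Subgroup.mem_top g)
  have key2 : ∀ x, (BS L G).Reachable (vert L G true 1) x := by
    intro x
    obtain ⟨g, hg⟩ := vert_surj x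
    rw [hg]
    cases x.1
    · exact (key g).trans (adj_vert true g).reachable
    · exact key g
  have : Nonempty (BV L G) := ⟨vert L G true 1⟩
  exact ⟨fun x y => (key2 x).symm.trans (key2 y)⟩

/-- A reduced sequence of edges. -/
def Zig (L G : Subgroup F) (b : ℕ → Bool) (g : ℕ → F) (n : ℕ) : Prop :=
  ∀ k < n, (g k)⁻¹ * g (k + 1) ∈ Fac L G (b k) ∧ (g k)⁻¹ * g (k + 1) ∉ Fac L G (!b k) ∧
    (k + 1 < n → b (k + 1) = !b k)

theorem not_sameFactor {L G : Subgroup F} {b : Bool} {u v : F} (h1 : u ∉ Fac L G (!b))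
    (h2 : v ∉ Fac L G b) : ¬ SameFactor L G u v := by
  unfold SameFactor
  cases b <;> simp [Fac] at * <;> tauto

theorem sameFactor_iff {L G : Subgroup F} {u v : F} :
    SameFactor L G u v ↔ ∃ b, u ∈ Fac L G b ∧ v ∈ Fac L G b := by
  unfold SameFactor
  simp [Fac]
  tauto

theorem mem_fac_union {L G : Subgroup F} {u : F} :
    u ∈ (L : Set F) ∪ (G : Set F) ↔ ∃ b, u ∈ Fac L G b := by
  simp [Fac]
  tauto

theorem prod_map_range (g : ℕ → F) (n : ℕ) :
    ((List.range n).map fun k => (g k)⁻¹ * g (k + 1)).prod = (g 0)⁻¹ * g n := by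
  induction n with
  | zero => simp
  | succ n ih => rw [List.range_succ, List.map_append, List.prod_append, ih]; simp

theorem zig_rep {L G : Subgroup F} {b : ℕ → Bool} {g : ℕ → F} {n : ℕ} (h : Zig L G b g n) :
    IsCanonicalRep L G ((g 0)⁻¹ * g n) ((List.range n).map fun k => (g k)⁻¹ * g (k + 1)) := by
  refine ⟨⟨?_, ?_⟩, prod_map_range g n⟩
  · intro x hx
    rw [List.mem_map] at hx
    obtain ⟨k, hk, rfl⟩ := hx
    exact mem_fac_union.2 ⟨b k, (h k (List.mem_range.1 hk)).1⟩
  · change List.IsChain _ _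
    rw [List.isChain_iff_getElem]
    intro i hi
    simp only [List.length_map, List.length_range] at hi
    simp only [List.getElem_map, List.getElem_range]
    refine not_sameFactor (b := b i) (h i (by omega)).2.1 ?_
    have h1 := (h i (by omega)).2.2 hi
    have h2 := (h (i + 1) hi).2.1
    rw [h1] at h2
    simpa using h2

theorem zig_ne {L G : Subgroup F} (hF : IsAmalgam L G) {b : ℕ → Bool} {g : ℕ → F} {n : ℕ}
    (h : Zig L G b g n) (hn : 2 ≤ n) : g 0 ≠ g n := by
  intro he
  have h1 := zig_rep h
  refine hF.2 _ h1.1 (by simpa using hn) ?_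
  rw [h1.2, he]; simp

theorem zig_notMem {L G : Subgroup F} (hF : IsAmalgam L G) {b : ℕ → Bool} {g : ℕ → F} {n : ℕ}
    (h : Zig L G b g n) (hn : 1 ≤ n) : (g 0)⁻¹ * g n ∉ L ⊓ G := by
  intro hH
  rcases Nat.lt_or_ge n 2 with h2 | h2
  · have : n = 1 := by omega
    subst this
    exact (h 0 (by omega)).2.1 ((mem_inf_fac (b 0)).1 hH).2
  · have hz : Zig L G b (Function.update g n (g 0)) n := by
      intro k hk
      obtain ⟨e1, e2, e3⟩ := h k hk
      rw [Function.update_of_ne (by omega : k ≠ n)]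
      by_cases hkn : k + 1 = n
      · have e4 : (g k)⁻¹ * g 0 = (g k)⁻¹ * g (k + 1) * ((g 0)⁻¹ * g n)⁻¹ := by
          subst hkn; group
        rw [hkn, Function.update_self, e4]
        have m := (mem_inf_fac (b k)).1 hH
        refine ⟨mul_mem e1 (inv_mem m.1), fun h5 => e2 ?_, fun h6 => by omega⟩
        have := mul_mem h5 m.2
        rwa [inv_mul_cancel_right] at this
      · rw [Function.update_of_ne hkn]
        exact ⟨e1, e2, e3⟩
    apply zig_ne hF hz h2
    rw [Function.update_of_ne (by omega : 0 ≠ n), Function.update_self]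

theorem bs_tree {L G : Subgroup F} (hF : IsAmalgam L G) : (BS L G).IsTree := by
  refine isTree_of_nb (bs_connected hF) ?_
  intro f n hn hadj hnb hcl
  -- types alternate
  have hty : ∀ k < n, (f (k + 1)).1 = !(f k).1 := fun k hk => adj_fst (hadj k hk)
  choose! g b hg1 hg2 using hadj
  have hb : ∀ k < n, b k = (f k).1 := by
    intro k hk
    have := hg1 k hk
    rw [this]; rfl
  have hlet : ∀ k, k + 1 < n → (g k)⁻¹ * g (k + 1) ∈ Fac L G (f (k + 1)).1 ∧
      (g k)⁻¹ * g (k + 1) ∉ Fac L G (!(f (k + 1)).1) := by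
    intro k hk
    have e1 := hg2 k (by omega)
    have e2 := hg1 (k + 1) hk
    have e3 := vert_eq.1 (e1.symm.trans e2)
    have e4 : (f (k + 1)).1 = !b k := by rw [e1]; rfl
    rw [e4]
    refine ⟨e3.2, fun e5 => hnb k (by omega) ?_⟩
    rw [hg1 k (by omega), hg2 (k + 1) hk]
    rw [vert_eq, ← e3.1]
    simp only [Bool.not_not] at e5 ⊢
    exact ⟨trivial, e5⟩
  have hz : Zig L G (fun k => (f (k + 1)).1) g (n - 1) := by
    intro k hk
    exact ⟨(hlet k (by omega)).1, (hlet k (by omega)).2, fun h => hty (k + 1) (by omega)⟩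
  have hl1 := hg2 (n - 1) (by omega)
  rw [show n - 1 + 1 = n by omega, ← hcl, hg1 0 (by omega), vert_eq] at hl1
  have hk' : (g (n - 1))⁻¹ * g 0 ∈ Fac L G (b 0) := by
    have := inv_mem hl1.2
    simpa using this
  by_cases hH : (g (n - 1))⁻¹ * g 0 ∈ Fac L G (!b 0)
  · apply zig_notMem hF hz (by omega)
    have := (mem_inf_fac (b 0)).2 ⟨hk', hH⟩
    have := inv_mem this
    simpa using this
  · have hz2 : Zig L G (fun k => (f (k + 1)).1) (Function.update g n (g 0)) n := by
      intro k hk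
      rw [Function.update_of_ne (by omega : k ≠ n)]
      by_cases hkn : k + 1 = n
      · have : k = n - 1 := by omega
        beta_reduce
        rw [hkn, Function.update_self, ← hcl, ← hb 0 (by omega), this]
        exact ⟨hk', hH, fun h => by omega⟩
      · rw [Function.update_of_ne hkn]
        exact ⟨(hlet k (by omega)).1, (hlet k (by omega)).2, fun h => hty (k + 1) h⟩
    apply zig_ne hF hz2 (by omega)
    rw [Function.update_of_ne (by omega : 0 ≠ n), Function.update_self]

theorem bd_tree {L G : Subgroup F} (hF : IsAmalgam L G) : TreeDist (bd L G) := treeDist (bs_tree hF)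

theorem bd_smul {L G : Subgroup F} (hF : IsAmalgam L G) (h : F) (x y : BV L G) :
    bd L G (h • x) (h • y) = bd L G x y := by
  have le : ∀ (h : F) (x y : BV L G), bd L G (h • x) (h • y) ≤ bd L G x y := by
    intro h x y
    obtain ⟨p, hp⟩ := (bs_connected hF).exists_walk_length_eq_dist x y
    have : ∀ {x y : BV L G} (p : (BS L G).Walk x y), ∃ q : (BS L G).Walk (h • x) (h • y),
        q.length = p.length := by
      intro x y p
      induction p with
      | nil => exact ⟨SimpleGraph.Walk.nil, rfl⟩
      | cons e _ ih =>
        obtain ⟨q, hq⟩ := ih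
        exact ⟨SimpleGraph.Walk.cons (adj_smul h e) q, by simp [hq]⟩
    obtain ⟨q, hq⟩ := this p
    unfold bd
    rw [← hp, ← hq]
    exact SimpleGraph.dist_le q
  apply le_antisymm (le h x y)
  have := le h⁻¹ (h • x) (h • y)
  simpa using this

end AmalgamFormalization

namespace AmalgamFormalization

variable {F : Type u} [Group F]

/-! ### Lengths -/

theorem exists_rep_le {L G : Subgroup F} : ∀ (n : ℕ) (l : List F), l.length = n →
    (∀ x ∈ l, x ∈ (L : Set F) ∪ (G : Set F)) →
    ∃ w, IsCanonicalRep L G l.prod w ∧ w.length ≤ l.length := by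
  intro n
  induction n with
  | zero =>
    intro l hl _
    have : l = [] := List.length_eq_zero_iff.1 hl
    subst this
    exact ⟨[], ⟨⟨by simp, List.IsChain.nil⟩, rfl⟩, le_rfl⟩
  | succ n ih =>
    intro l hl hmem
    by_cases hch : List.IsChain (fun a b => ¬ SameFactor L G a b) l
    · exact ⟨l, ⟨⟨hmem, hch⟩, rfl⟩, le_rfl⟩
    · rw [List.isChain_iff_getElem] at hch
      push Not at hch
      obtain ⟨i, hi, hs⟩ := hch
      have hsplit : l = l.take i ++ (l[i] :: l[i + 1] :: l.drop (i + 2)) := by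
        rw [← List.drop_eq_getElem_cons (i := i + 1), ← List.drop_eq_getElem_cons,
          List.take_append_drop]
      have hp : (l.take i ++ ((l[i] * l[i + 1]) :: l.drop (i + 2))).prod = l.prod := by
        have h2 := congrArg List.prod hsplit
        rw [h2]
        simp only [List.prod_append, List.prod_cons, mul_assoc]
      obtain ⟨w, hw1, hw2⟩ := ih (l.take i ++ ((l[i] * l[i + 1]) :: l.drop (i + 2)))
        (by simp; omega) (by
          intro x hx
          rw [List.mem_append, List.mem_cons] at hx
          rcases hx with hx | rfl | hx
          · exact hmem x (List.mem_of_mem_take hx)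
          · obtain ⟨b, h1, h2⟩ := sameFactor_iff.1 hs
            exact mem_fac_union.2 ⟨b, mul_mem h1 h2⟩
          · exact hmem x (List.mem_of_mem_drop hx))
      rw [hp] at hw1
      refine ⟨w, hw1, hw2.trans ?_⟩
      simp; omega

theorem exists_rep {L G : Subgroup F} (hF : IsAmalgam L G) (p : F) :
    ∃ w, IsCanonicalRep L G p w := by
  have h1 : p ∈ Subgroup.closure ((L : Set F) ∪ (G : Set F)) := by
    rw [Subgroup.closure_union, Subgroup.closure_eq, Subgroup.closure_eq, hF.1]
    exact Subgroup.mem_top p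
  rw [← Subgroup.mem_toSubmonoid, Subgroup.closure_toSubmonoid] at h1
  obtain ⟨l, h2, rfl⟩ := Submonoid.exists_list_of_mem_closure h1
  obtain ⟨w, hw, _⟩ := exists_rep_le (L := L) (G := G) _ l rfl (by
    intro x hx
    rcases h2 x hx with h | h
    · exact h
    · rw [Set.mem_inv, mem_fac_union] at h
      rw [mem_fac_union]
      obtain ⟨b, hb⟩ := h
      exact ⟨b, by simpa using inv_mem hb⟩)
  exact ⟨w, hw⟩

theorem len_spec {L G : Subgroup F} (hF : IsAmalgam L G) (p : F) :
    ∃ w, IsCanonicalRep L G p w ∧ w.length = len L G p := by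
  obtain ⟨w, hw⟩ := exists_rep hF p
  exact Nat.sInf_mem (s := {n | ∃ w : List F, IsCanonicalRep L G p w ∧ w.length = n}) ⟨_, w, hw, rfl⟩

theorem len_le {L G : Subgroup F} {p : F} {w : List F} (hw : IsCanonicalRep L G p w) :
    len L G p ≤ w.length := Nat.sInf_le ⟨w, hw, rfl⟩

theorem len_mul_le {L G : Subgroup F} (hF : IsAmalgam L G) (p q : F) :
    len L G (p * q) ≤ len L G p + len L G q := by
  obtain ⟨w, hw, h1⟩ := len_spec hF p
  obtain ⟨w', hw', h1'⟩ := len_spec hF q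
  obtain ⟨v, hv, h2⟩ := exists_rep_le (L := L) (G := G) _ (w ++ w') rfl (by
    intro x hx
    rcases List.mem_append.1 hx with h | h
    · exact hw.1.1 x h
    · exact hw'.1.1 x h)
  rw [List.prod_append, hw.2, hw'.2] at hv
  have := len_le hv
  rw [List.length_append] at h2
  omega

theorem len_fac {L G : Subgroup F} {b : Bool} {u : F} (hu : u ∈ Fac L G b) : len L G u ≤ 1 := by
  refine len_le (w := [u]) ⟨⟨?_, List.IsChain.singleton _⟩, by simp⟩
  intro x hx
  rw [List.mem_singleton] at hx
  subst hx
  exact mem_fac_union.2 ⟨b, hu⟩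

theorem len_one {L G : Subgroup F} : len L G (1 : F) = 0 := by
  have := len_le (L := L) (G := G) (p := 1) (w := []) ⟨⟨by simp, List.IsChain.nil⟩, rfl⟩
  simpa using this

theorem not_mem_of_ne {L G : Subgroup F} {b b' : Bool} {u v : F} (hs : ¬ SameFactor L G u v)
    (hu : u ∈ Fac L G b) (hv : v ∈ Fac L G b') : b' = !b := by
  by_contra h
  have : b' = b := by cases b <;> cases b' <;> simp_all
  subst this
  exact hs (sameFactor_iff.2 ⟨_, hu, hv⟩)

theorem rep_zig {L G : Subgroup F} {p : F} {w : List F} (hw : IsCanonicalRep L G p w)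
    (h : 2 ≤ w.length ∨ p ∉ L ⊓ G) :
    ∃ b, Zig L G b (fun k => (w.take k).prod) w.length := by
  classical
  obtain ⟨⟨hmem, hch⟩, hp⟩ := hw
  have hch' : List.IsChain (fun a b => ¬ SameFactor L G a b) w := hch
  rw [List.isChain_iff_getElem] at hch'
  have hlet : ∀ k (hk : k < w.length), ((w.take k).prod)⁻¹ * (w.take (k + 1)).prod = w[k] := by
    intro k hk
    rw [List.take_succ_eq_append_getElem hk, List.prod_append]
    simp
  have hfac : ∀ k, ∃ b, ∀ hk : k < w.length, w[k] ∈ Fac L G b := by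
    intro k
    by_cases hk : k < w.length
    · obtain ⟨b, hb⟩ := mem_fac_union.1 (hmem w[k] (List.getElem_mem hk))
      exact ⟨b, fun _ => hb⟩
    · exact ⟨true, fun h => absurd h hk⟩
  choose b hb using hfac
  have hnH : ∀ k (hk : k < w.length), w[k] ∉ L ⊓ G := by
    intro k hk hH
    rcases h with h | h
    · rcases Nat.eq_zero_or_pos k with rfl | h0
      · have h1 := hch' 0 (by omega)
        refine h1 (sameFactor_iff.2 ⟨b 1, ?_, hb 1 (by omega)⟩)
        exact ((mem_inf_fac (b 1)).1 hH).1
      · obtain ⟨j, rfl⟩ : ∃ j, k = j + 1 := ⟨k - 1, by omega⟩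
        have h1 := hch' j (by omega)
        refine h1 (sameFactor_iff.2 ⟨b j, hb j (by omega), ?_⟩)
        exact ((mem_inf_fac (b j)).1 hH).1
    · by_cases hl : w.length = 1
      · apply h
        obtain ⟨a, rfl⟩ := List.length_eq_one_iff.1 hl
        have : k = 0 := by omega
        subst this
        rw [← hp]
        simpa using hH
      · rcases Nat.eq_zero_or_pos k with rfl | h0
        · have h1 := hch' 0 (by omega)
          refine h1 (sameFactor_iff.2 ⟨b 1, ?_, hb 1 (by omega)⟩)
          exact ((mem_inf_fac (b 1)).1 hH).1
        · obtain ⟨j, rfl⟩ : ∃ j, k = j + 1 := ⟨k - 1, by omega⟩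
          have h1 := hch' j (by omega)
          refine h1 (sameFactor_iff.2 ⟨b j, hb j (by omega), ?_⟩)
          exact ((mem_inf_fac (b j)).1 hH).1
  refine ⟨b, fun k hk => ?_⟩
  beta_reduce
  rw [hlet k hk]
  refine ⟨hb k hk, fun h2 => hnH k hk ((mem_inf_fac (b k)).2 ⟨hb k hk, h2⟩), fun h2 => ?_⟩
  exact not_mem_of_ne (hch' k h2) (hb k hk) (hb (k + 1) h2)

/-- The sum of distances between the endpoints of two edges. -/
noncomputable def edgeSum (L G : Subgroup F) (g g' : F) : ℕ :=
  bd L G (vert L G true g) (vert L G true g') + bd L G (vert L G true g) (vert L G false g') +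
  bd L G (vert L G false g) (vert L G true g') + bd L G (vert L G false g) (vert L G false g')

theorem edgeSum_eq {L G : Subgroup F} (g g' : F) (c c' : Bool) : edgeSum L G g g' =
    bd L G (vert L G c g) (vert L G c' g') + bd L G (vert L G c g) (vert L G (!c') g') +
    bd L G (vert L G (!c) g) (vert L G c' g') + bd L G (vert L G (!c) g) (vert L G (!c') g') := by
  unfold edgeSum
  cases c <;> cases c' <;> simp only [Bool.not_true, Bool.not_false] <;> omega

theorem zig_path {L G : Subgroup F} (hF : IsAmalgam L G) {b : ℕ → Bool} {g : ℕ → F} {n : ℕ}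
    (h : Zig L G b g n) (hb : ∀ k, b (k + 1) = !b k) {i j : ℕ} (hij : i ≤ j) (hj : j ≤ n + 1) :
    bd L G (vert L G (!b i) (g (min i n))) (vert L G (!b j) (g (min j n))) = j - i := by
  have hadj : ∀ k ≤ n, (BS L G).Adj (vert L G (!b k) (g (min k n)))
      (vert L G (!b (k + 1)) (g (min (k + 1) n))) := by
    intro k hk
    rcases Nat.lt_or_ge k n with h1 | h1
    · rw [min_eq_left hk, min_eq_left (by omega : k + 1 ≤ n), hb k]
      have : vert L G (b k) (g (k + 1)) = vert L G (b k) (g k) :=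
        (vert_eq.2 ⟨rfl, (h k h1).1⟩).symm
      rw [Bool.not_not, this]
      simpa using adj_vert (L := L) (G := G) (!b k) (g k)
    · have : k = n := by omega
      subst this
      rw [min_self, min_eq_right (by omega : k ≤ k + 1), hb k]
      exact adj_vert _ _
  have hnb : ∀ k, k < n → vert L G (!b k) (g (min k n)) ≠
      vert L G (!b (k + 2)) (g (min (k + 2) n)) := by
    intro k hk he
    have e0 : vert L G (!b (k + 2)) (g (min (k + 2) n)) = vert L G (!b k) (g (k + 1)) := by
      rw [hb (k + 1), hb k]
      rcases Nat.lt_or_ge (k + 1) n with h1 | h1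
      · rw [min_eq_left (by omega : k + 2 ≤ n)]
        have := (h (k + 1) h1).1
        rw [hb k] at this
        rw [vert_eq]
        have := inv_mem this
        simpa using this
      · rw [min_eq_right (by omega : n ≤ k + 2), show n = k + 1 by omega]
        simp
    rw [e0, min_eq_left (by omega : k ≤ n), vert_eq] at he
    exact (h k hk).2.1 he.2
  have := nb_dist (bs_tree hF) (fun k => vert L G (!b (i + k)) (g (min (i + k) n))) (j - i)
    (fun k hk => hadj (i + k) (by omega)) (fun k hk => hnb (i + k) (by omega))
  simpa [bd, Nat.add_sub_cancel' hij] using this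

theorem zig_alt {L G : Subgroup F} {b : ℕ → Bool} {g : ℕ → F} {n : ℕ}
    (h : Zig L G b g n) : ∃ b', Zig L G b' g n ∧ ∀ k, b' (k + 1) = !b' k := by
  have key : ∀ k < n, b k = xor (b 0) k.bodd := by
    intro k
    induction k with
    | zero => simp
    | succ k ih =>
      intro hk
      rw [(h k (by omega)).2.2 hk, ih (by omega)]
      simp
  refine ⟨fun k => xor (b 0) k.bodd, fun k hk => ?_, by simp⟩
  beta_reduce
  rw [← key k hk]
  exact ⟨(h k hk).1, (h k hk).2.1, fun _ => by rw [key k hk]; simp⟩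

theorem zig_edgeSum {L G : Subgroup F} (hF : IsAmalgam L G) {b : ℕ → Bool} {g : ℕ → F} {n : ℕ}
    (h : Zig L G b g n) (hn : 1 ≤ n) : edgeSum L G (g 0) (g n) = 4 * n := by
  obtain ⟨b', h', hb'⟩ := zig_alt h
  have e1 := zig_path hF h' hb' (i := 0) (j := n) (by omega) (by omega)
  have e2 := zig_path hF h' hb' (i := 0) (j := n + 1) (by omega) (by omega)
  have e3 := zig_path hF h' hb' (i := 1) (j := n) (by omega) (by omega)
  have e4 := zig_path hF h' hb' (i := 1) (j := n + 1) (by omega) (by omega)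
  have e5 : vert L G (!b' 1) (g (min 1 n)) = vert L G (b' 0) (g 0) := by
    rw [min_eq_left hn, hb' 0, Bool.not_not]
    exact (vert_eq.2 ⟨rfl, (h' 0 (by omega)).1⟩).symm
  rw [e5] at e3 e4
  simp only [min_eq_right (by omega : n ≤ n + 1), min_self, Nat.zero_min, hb' n, Bool.not_not]
    at e1 e2 e3 e4
  rw [edgeSum_eq _ _ (b' 0) (b' n)]
  omega

theorem len_zig {L G : Subgroup F} (hF : IsAmalgam L G) {b : ℕ → Bool} {g : ℕ → F} {n : ℕ}
    (h : Zig L G b g n) (hn : 1 ≤ n) : len L G ((g 0)⁻¹ * g n) = n := by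
  obtain ⟨w, hw, hl⟩ := len_spec hF ((g 0)⁻¹ * g n)
  have hH := zig_notMem hF h hn
  obtain ⟨b', hb'⟩ := rep_zig hw (Or.inr hH)
  have h1 : 1 ≤ w.length := by
    by_contra h0
    have : w = [] := List.length_eq_zero_iff.1 (by omega)
    subst this
    apply hH
    rw [← hw.2]
    exact one_mem _
  have h2 := zig_edgeSum hF hb' h1
  have hz2 : Zig L G b (fun k => (g 0)⁻¹ * g k) n := by
    intro k hk
    have := h k hk
    have e : ((g 0)⁻¹ * g k)⁻¹ * ((g 0)⁻¹ * g (k + 1)) = (g k)⁻¹ * g (k + 1) := by group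
    beta_reduce
    rw [e]
    exact this
  have h3 := zig_edgeSum hF hz2 hn
  beta_reduce at h2 h3
  rw [List.take_length, hw.2, List.take_zero, List.prod_nil] at h2
  rw [inv_mul_cancel] at h3
  omega

end AmalgamFormalization

namespace AmalgamFormalization

variable {F : Type u} [Group F]

/-! ### Axes -/

/-- A periodic bi-infinite reduced sequence of edges. -/
structure Ax (L G : Subgroup F) (r : F) (n : ℕ) (g : ℤ → F) (b : ℤ → Bool) : Prop where
  pos : 0 < n
  even : Even n
  alt : ∀ k, b (k + 1) = !b k
  mem : ∀ k, (g k)⁻¹ * g (k + 1) ∈ Fac L G (b k)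
  nmem : ∀ k, (g k)⁻¹ * g (k + 1) ∉ Fac L G (!b k)
  per : ∀ k, g (k + n) = r * g k

/-- Vertices of an axis. -/
def pt (L G : Subgroup F) (g : ℤ → F) (b : ℤ → Bool) (k : ℤ) : BV L G := vert L G (b k) (g k)

namespace Ax

variable {L G : Subgroup F} {r : F} {n : ℕ} {g : ℤ → F} {b : ℤ → Bool}

theorem conj (h : Ax L G r n g b) (c : F) : Ax L G (c * r * c⁻¹) n (fun k => c * g k) b where
  pos := h.pos
  even := h.even
  alt := h.alt
  mem k := by
    have e : (c * g k)⁻¹ * (c * g (k + 1)) = (g k)⁻¹ * g (k + 1) := by group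
    rw [e]; exact h.mem k
  nmem k := by
    have e : (c * g k)⁻¹ * (c * g (k + 1)) = (g k)⁻¹ * g (k + 1) := by group
    rw [e]; exact h.nmem k
  per k := by rw [h.per k]; group

theorem shift (h : Ax L G r n g b) (t : ℤ) :
    Ax L G r n (fun k => g (k + t)) (fun k => b (k + t)) where
  pos := h.pos
  even := h.even
  alt k := by
    have := h.alt (k + t)
    rw [← this]; congr 1; ring
  mem k := by
    have := h.mem (k + t)
    rwa [show k + 1 + t = k + t + 1 by ring]
  nmem k := by
    have := h.nmem (k + t)
    rwa [show k + 1 + t = k + t + 1 by ring]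
  per k := by
    have := h.per (k + t)
    rwa [show k + n + t = k + t + n by ring]

theorem inv (h : Ax L G r n g b) : Ax L G r⁻¹ n (fun k => g (-k)) (fun k => b (-k - 1)) where
  pos := h.pos
  even := h.even
  alt k := by
    have := h.alt (-(k + 1) - 1)
    rw [show -(k + 1) - 1 + 1 = -k - 1 by ring] at this
    rw [this]; simp
  mem k := by
    have := inv_mem (h.mem (-k - 1))
    rw [show -k - 1 + 1 = -k by ring] at this
    rw [show -(k + 1) = -k - 1 by ring]
    simpa using this
  nmem k := by
    intro h2
    have h3 := h.nmem (-k - 1)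
    rw [show -k - 1 + 1 = -k by ring] at h3
    apply h3
    rw [show -(k + 1) = -k - 1 by ring] at h2
    simpa using inv_mem h2
  per k := by
    have := h.per (-(k + n))
    rw [show -(k + n) + (n : ℤ) = -k by ring] at this
    rw [this]; group

theorem mulH (h : Ax L G r n g b) {u : F} (hu : u ∈ L ⊓ G) : Ax L G r n (fun k => g k * u) b where
  pos := h.pos
  even := h.even
  alt := h.alt
  mem k := by
    have e : (g k * u)⁻¹ * (g (k + 1) * u) = u⁻¹ * ((g k)⁻¹ * g (k + 1)) * u := by group
    have hu' := (mem_inf_fac (b k)).1 hu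
    rw [e]; exact mul_mem (mul_mem (inv_mem hu'.1) (h.mem k)) hu'.1
  nmem k h2 := by
    have e : (g k)⁻¹ * g (k + 1) = u * ((g k * u)⁻¹ * (g (k + 1) * u)) * u⁻¹ := by group
    have hu' := (mem_inf_fac (b k)).1 hu
    apply h.nmem k
    rw [e]; exact mul_mem (mul_mem hu'.2 h2) (inv_mem hu'.2)
  per k := by rw [h.per k]; group

theorem b_add (h : Ax L G r n g b) (k : ℤ) (m : ℕ) : b (k + m) = xor (b k) m.bodd := by
  induction m with
  | zero => simp
  | succ m ih =>
    have := h.alt (k + m)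
    rw [ih] at this
    push_cast
    rw [← add_assoc, this]
    simp

theorem b_per (h : Ax L G r n g b) (k : ℤ) : b (k + n) = b k := by
  rw [h.b_add]
  obtain ⟨m, hm⟩ := h.even
  rw [hm]
  simp

theorem pt_next (h : Ax L G r n g b) (k : ℤ) : vert L G (b k) (g (k + 1)) = pt L G g b k :=
  (vert_eq.2 ⟨rfl, h.mem k⟩).symm

theorem smul_pt (h : Ax L G r n g b) (k : ℤ) : r • pt L G g b k = pt L G g b (k + n) := by
  unfold pt
  rw [smul_vert, h.b_per, h.per]

theorem zpow_pt (h : Ax L G r n g b) (e k : ℤ) :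
    r ^ e • pt L G g b k = pt L G g b (k + e * n) := by
  induction e with
  | zero => simp
  | succ i ih =>
    rw [zpow_add_one, ((Commute.refl r).zpow_left i).eq, mul_smul, ih, h.smul_pt]
    congr 1; push_cast; ring
  | pred i ih =>
    rw [zpow_sub_one, ((Commute.refl r).zpow_left (-(i : ℤ))).inv_right.eq, mul_smul, ih,
      inv_smul_eq_iff, h.smul_pt]
    congr 1; ring

theorem zig (h : Ax L G r n g b) (i : ℤ) (m : ℕ) :
    Zig L G (fun k => b (i + k)) (fun k => g (i + k)) m := by
  intro k _
  have e : i + ((k + 1 : ℕ) : ℤ) = i + k + 1 := by push_cast; ring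
  beta_reduce
  rw [e]
  exact ⟨h.mem _, h.nmem _, fun _ => h.alt _⟩

theorem dist_add (h : Ax L G r n g b) (hF : IsAmalgam L G) (i : ℤ) (m : ℕ) :
    bd L G (pt L G g b i) (pt L G g b (i + m)) = m := by
  have h1 := zig_path hF (h.zig (i + 1) m) (by
    intro k
    have e : i + 1 + ((k + 1 : ℕ) : ℤ) = i + 1 + k + 1 := by push_cast; ring
    rw [e, h.alt]) (i := 0) (j := m) (by omega) (by omega)
  beta_reduce at h1
  rw [Nat.zero_min, min_self] at h1
  simp only [Nat.cast_zero, add_zero] at h1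
  rw [h.alt i, Bool.not_not, h.pt_next, show i + 1 + (m : ℤ) = i + m + 1 by ring, h.alt,
    Bool.not_not, h.pt_next] at h1
  simpa using h1

theorem dist_pt (h : Ax L G r n g b) (hF : IsAmalgam L G) (i j : ℤ) :
    bd L G (pt L G g b i) (pt L G g b j) = (j - i).natAbs := by
  rcases le_total i j with hij | hij
  · have := h.dist_add hF i (j - i).natAbs
    rwa [show i + ((j - i).natAbs : ℤ) = j by omega] at this
  · have := h.dist_add hF j (j - i).natAbs
    rw [show j + ((j - i).natAbs : ℤ) = i by omega] at this
    rwa [(bd_tree hF).symm]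

theorem len_eq (h : Ax L G r n g b) (hF : IsAmalgam L G) (i : ℤ) (m : ℕ) (hm : 1 ≤ m) :
    len L G ((g i)⁻¹ * g (i + m)) = m := by
  have := len_zig hF (h.zig i m) hm
  simpa using this

theorem btw_eq (h : Ax L G r n g b) (hF : IsAmalgam L G) {i j : ℤ} (hij : i ≤ j) {z : BV L G}
    (hz : Btw (bd L G) (pt L G g b i) z (pt L G g b j)) :
    z = pt L G g b (i + bd L G (pt L G g b i) z) ∧ i + bd L G (pt L G g b i) z ≤ j := by
  have h1 := h.dist_pt hF i j
  set t := bd L G (pt L G g b i) z with ht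
  have h0 := hz
  unfold Btw at h0
  have h2 : i + (t : ℤ) ≤ j := by omega
  refine ⟨(bd_tree hF).uniq hz ?_ ?_, h2⟩
  · unfold Btw
    rw [h.dist_pt hF, h.dist_pt hF, h1]; omega
  · rw [h.dist_pt hF]; omega

theorem conv (h : Ax L G r n g b) (hF : IsAmalgam L G) :
    Conv (bd L G) (Set.range (pt L G g b)) := by
  rintro _ ⟨i, rfl⟩ _ ⟨j, rfl⟩ z hz
  rcases le_total i j with hij | hij
  · exact ⟨_, (h.btw_eq hF hij hz).1.symm⟩
  · exact ⟨_, (h.btw_eq hF hij ((bd_tree hF).btw_symm hz)).1.symm⟩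

theorem disp (h : Ax L G r n g b) (hF : IsAmalgam L G) (x : BV L G) :
    ∃ π ∈ Set.range (pt L G g b), ∀ e : ℤ, e ≠ 0 →
      bd L G x (r ^ e • x) = 2 * bd L G x π + (e * n).natAbs := by
  obtain ⟨π, hπ⟩ := (bd_tree hF).gate_exists (h.conv hF) ⟨_, 0, rfl⟩ x
  refine ⟨π, hπ.1, fun e he => ?_⟩
  have hg : Gate (bd L G) (Set.range (pt L G g b)) (r ^ e • x) (r ^ e • π) := by
    obtain ⟨⟨k, rfl⟩, h2⟩ := hπ
    refine ⟨⟨_, (h.zpow_pt e k).symm⟩, ?_⟩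
    rintro _ ⟨j, rfl⟩
    have h3 := h2 _ ⟨j + (-e) * n, rfl⟩
    have h4 := h.zpow_pt e (j + (-e) * n)
    rw [show j + (-e) * n + e * n = j by ring] at h4
    rw [← h4]
    unfold Btw at *
    rw [bd_smul hF, bd_smul hF, bd_smul hF, h3]
  obtain ⟨⟨k, rfl⟩, h2⟩ := id hπ
  have hd : bd L G (pt L G g b k) (r ^ e • pt L G g b k) = (e * n).natAbs := by
    rw [h.zpow_pt, h.dist_pt hF]; congr 1; ring
  have hp := h.pos
  have hne : (e * n).natAbs ≠ 0 := by
    rw [Int.natAbs_ne_zero]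
    exact mul_ne_zero he (by exact_mod_cast hp.ne')
  have := (bd_tree hF).gate_btw hπ hg (by
    intro he2
    rw [← he2, (bd_tree hF).self] at hd
    exact hne hd.symm)
  rw [this, hd, bd_smul hF, (bd_tree hF).symm (pt L G g b k) x]; ring

end Ax

/-- Translation length. -/
noncomputable def trl (L G : Subgroup F) (r : F) : ℕ := sInf {m | ∃ x, bd L G x (r • x) = m}

/-- Points of minimal displacement. -/
def MinSet (L G : Subgroup F) (r : F) : Set (BV L G) :=
  {x | ∀ y, bd L G x (r • x) ≤ bd L G y (r • y)}

namespace Ax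

variable {L G : Subgroup F} {r : F} {n : ℕ} {g : ℤ → F} {b : ℤ → Bool}

theorem disp_ge (h : Ax L G r n g b) (hF : IsAmalgam L G) (x : BV L G) {e : ℤ} (he : e ≠ 0) :
    n ≤ bd L G x (r ^ e • x) := by
  obtain ⟨π, _, h2⟩ := h.disp hF x
  rw [h2 e he, Int.natAbs_mul, Int.natAbs_natCast]
  have : 1 ≤ e.natAbs := by omega
  nlinarith

theorem disp_pt (h : Ax L G r n g b) (hF : IsAmalgam L G) (k : ℤ) :
    bd L G (pt L G g b k) (r • pt L G g b k) = n := by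
  rw [h.smul_pt, h.dist_add hF]

theorem trl_eq (h : Ax L G r n g b) (hF : IsAmalgam L G) : trl L G r = n := by
  unfold trl
  apply le_antisymm
  · exact Nat.sInf_le ⟨_, h.disp_pt hF 0⟩
  · obtain ⟨x, hx⟩ := Nat.sInf_mem (s := {m | ∃ x, bd L G x (r • x) = m})
      ⟨_, vert L G true 1, rfl⟩
    rw [← hx]
    simpa using h.disp_ge hF x one_ne_zero

theorem minSet_eq (h : Ax L G r n g b) (hF : IsAmalgam L G) :
    MinSet L G r = Set.range (pt L G g b) := by
  ext x
  constructor
  · intro hx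
    obtain ⟨π, hπ, h2⟩ := h.disp hF x
    have h3 := h2 1 one_ne_zero
    have h4 := hx (pt L G g b 0)
    rw [h.disp_pt hF] at h4
    rw [zpow_one] at h3
    have : x = π := (bd_tree hF).eq _ _ (by omega)
    rwa [this]
  · rintro ⟨k, rfl⟩ y
    rw [h.disp_pt hF]
    simpa using h.disp_ge hF y one_ne_zero

/-- An axis element with base point on the axis is cyclically reduced. -/
theorem cyc (h : Ax L G r n g b) (hF : IsAmalgam L G) (h0 : g 0 = 1) :
    len L G r = n ∧ IsCyclicallyReduced L G r ∧ IsWeaklyCyclicallyReduced L G r := by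
  have hn := h.pos
  have hr : (g 0)⁻¹ * g n = r := by
    have := h.per 0
    rw [zero_add] at this
    rw [this, h0]; simp
  have hl := h.len_eq hF 0 n hn
  rw [zero_add, hr] at hl
  have hrep := zig_rep (h.zig 0 n)
  simp only [Nat.cast_zero, zero_add, hr] at hrep
  have hlast : b ((n - 1 : ℕ) : ℤ) = !b 0 := by
    have h1 := h.alt ((n - 1 : ℕ) : ℤ)
    rw [show ((n - 1 : ℕ) : ℤ) + 1 = 0 + n by omega, h.b_per] at h1
    rw [h1]; simp
  have hm1 := h.mem 0
  have hn1 := h.nmem 0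
  have hm2 := h.mem ((n - 1 : ℕ) : ℤ)
  have hn2 := h.nmem ((n - 1 : ℕ) : ℤ)
  rw [hlast] at hm2 hn2
  rw [Bool.not_not] at hn2
  have hends : ∀ x y : F, ((List.range n).map fun k : ℕ => (g (k : ℤ))⁻¹ * g ((k + 1 : ℕ) : ℤ)).head?
      = some x → ((List.range n).map fun k : ℕ => (g (k : ℤ))⁻¹ * g ((k + 1 : ℕ) : ℤ)).getLast?
      = some y → x = (g 0)⁻¹ * g (0 + 1) ∧
        y = (g ((n - 1 : ℕ) : ℤ))⁻¹ * g (((n - 1 : ℕ) : ℤ) + 1) := by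
    intro x y hx hy
    rw [List.head?_eq_getElem?] at hx
    rw [List.getLast?_eq_getElem?] at hy
    simp at hx hy
    obtain ⟨a, ha, rfl⟩ := hy
    have : a = n - 1 := by
      rw [List.getElem?_eq_some_iff] at ha
      obtain ⟨_, h2⟩ := ha
      simpa using h2.symm
    subst this
    obtain ⟨a, ha, rfl⟩ := hx
    have : a = 0 := by
      rw [List.getElem?_eq_some_iff] at ha
      obtain ⟨_, h2⟩ := ha
      simpa using h2.symm
    subst this
    simp
  refine ⟨hl, Or.inr ⟨_, hrep, ?_⟩, Or.inr ⟨_, hrep, ?_⟩⟩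
  · intro x y hx hy
    obtain ⟨rfl, rfl⟩ := hends x y hx hy
    exact not_sameFactor hn1 hn2
  · intro x y hx hy hxy
    obtain ⟨rfl, rfl⟩ := hends x y hx hy
    apply hn1
    have := mul_mem ((mem_inf_fac (b 0)).1 hxy).2 (inv_mem hm2)
    rwa [mul_inv_cancel_right] at this

end Ax

end AmalgamFormalization

namespace AmalgamFormalization

variable {F : Type u} [Group F]

/-- Separation of the letters of an axis. -/
def Sep (L G : Subgroup F) (n : ℕ) (g : ℤ → F) : Prop :=
  ∃ ε : ℤ, ∀ i j : ℤ, 2 ∣ i - ε → 2 ∣ j - ε → ¬ (n : ℤ) ∣ i - j → ∀ u ∈ L ⊓ G, ∀ v ∈ L ⊓ G,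
    ((g i)⁻¹ * g (i + 1))⁻¹ ≠ u * ((g j)⁻¹ * g (j + 1)) * v

theorem Sep.conj {L G : Subgroup F} {n : ℕ} {g : ℤ → F} (h : Sep L G n g) (c : F) :
    Sep L G n (fun k => c * g k) := by
  obtain ⟨ε, h⟩ := h
  refine ⟨ε, fun i j hi hj hij u hu v hv he => h i j hi hj hij u hu v hv ?_⟩
  have e : ∀ k, (c * g k)⁻¹ * (c * g (k + 1)) = (g k)⁻¹ * g (k + 1) := by intro k; group
  beta_reduce at he
  rwa [e, e] at he

theorem Sep.inv {L G : Subgroup F} {n : ℕ} {g : ℤ → F} (h : Sep L G n g) :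
    Sep L G n (fun k => g (-k)) := by
  obtain ⟨ε, h⟩ := h
  refine ⟨-ε - 1, fun i j hi hj hij u hu v hv he => ?_⟩
  refine h (-j - 1) (-i - 1) (by omega) (by omega) ?_ u⁻¹ (inv_mem hu) v⁻¹ (inv_mem hv) ?_
  · intro hd
    apply hij
    rwa [show -j - 1 - (-i - 1) = i - j by ring] at hd
  · beta_reduce at he
    rw [show -(i + 1) = -i - 1 by ring, show -(j + 1) = -j - 1 by ring] at he
    rw [show -i - 1 + 1 = -i by ring, show -j - 1 + 1 = -j by ring]
    have e4 : (g (-i - 1))⁻¹ * g (-i) = u * ((g (-j))⁻¹ * g (-j - 1)) * v := by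
      rw [← he]; group
    rw [e4]; group

theorem ax_of_rep {L G : Subgroup F} {n : ℕ} (hn : 2 ≤ n) (hev : Even n) {x : Fin n → F} {r : F}
    (hrep : IsCanonicalRep L G r (List.ofFn x)) :
    ∃ g b, Ax L G r n g b ∧ g 0 = 1 ∧ ∀ (k : ℤ) (i : Fin n), (i : ℤ) = k % n →
      (g k)⁻¹ * g (k + 1) = x i := by
  obtain ⟨b0, hz0⟩ := rep_zig hrep (Or.inl (by simpa using hn))
  obtain ⟨b', hz, hb'⟩ := zig_alt hz0
  rw [List.length_ofFn] at hz
  have hnz : (0 : ℤ) < n := by omega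
  have hlet : ∀ (k : ℤ) (i : Fin n), (i : ℤ) = k % n →
      (r ^ (k / n) * ((List.ofFn x).take (k % n).toNat).prod)⁻¹ *
        (r ^ ((k + 1) / n) * ((List.ofFn x).take ((k + 1) % n).toNat).prod) = 
        (((List.ofFn x).take i).prod)⁻¹ * ((List.ofFn x).take (i + 1)).prod := by
    intro k i hi
    have e1 : (k % n).toNat = i := by omega
    have hdm := Int.emod_add_mul_ediv k n
    rcases Nat.lt_or_ge (i + 1) n with h1 | h1
    · have e2 : (k + 1) % n = i + 1 ∧ (k + 1) / n = k / n := by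
        rw [and_comm, Int.ediv_emod_unique hnz]
        refine ⟨by rw [hi]; linarith, by omega, by omega⟩
      rw [e2.1, e2.2, e1, show ((i : ℤ) + 1).toNat = (i : ℕ) + 1 by omega]
      group
    · have e2 : (k + 1) % n = 0 ∧ (k + 1) / n = k / n + 1 := by
        rw [and_comm, Int.ediv_emod_unique hnz]
        have : (i : ℤ) + 1 = n := by omega
        refine ⟨?_, by omega, by omega⟩
        rw [mul_add]; linarith
      have e3 : (List.ofFn x).take (i + 1) = List.ofFn x :=
        List.take_of_length_le (by simpa using h1)
      rw [e2.1, e2.2, e1, e3, hrep.2]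
      simp only [Int.toNat_zero, List.take_zero, List.prod_nil, zpow_add_one]
      group
  have hx : ∀ i : Fin n, (((List.ofFn x).take i).prod)⁻¹ * ((List.ofFn x).take (i + 1)).prod
      = x i := by
    intro i
    rw [List.take_succ_eq_append_getElem (by simp), List.prod_append]
    simp
  have hi : ∀ k : ℤ, ∃ i : Fin n, (i : ℤ) = k % n := by
    intro k
    have h1 := Int.emod_nonneg k hnz.ne'
    have h2 := Int.emod_lt_of_pos k hnz
    exact ⟨⟨(k % n).toNat, by omega⟩, by simpa using h1⟩
  have hbk : ∀ k : ℕ, b' k = xor (b' 0) k.bodd := by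
    intro k
    induction k with
    | zero => simp
    | succ k ih => rw [hb', ih]; simp
  have hbi : ∀ (k : ℤ) (i : Fin n), (i : ℤ) = k % n → xor (b' 0) k.bodd = b' i := by
    intro k i hik
    rw [hbk i]
    have hdm := Int.emod_add_mul_ediv k n
    rw [← hik] at hdm
    obtain ⟨m, hm⟩ := hev
    have : Int.bodd (n : ℤ) = false := by rw [hm]; simp
    rw [← hdm, Int.bodd_add, Int.bodd_mul, this]
    simp
  refine ⟨fun k => r ^ (k / n) * ((List.ofFn x).take (k % n).toNat).prod,
    fun k => xor (b' 0) k.bodd, ⟨by omega, hev, ?_, ?_, ?_, ?_⟩, by simp, ?_⟩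
  · intro k; simp [Int.bodd_add]
  · intro k
    obtain ⟨i, hik⟩ := hi k
    beta_reduce
    rw [hlet k i hik, hbi k i hik]
    exact (hz i i.2).1
  · intro k
    obtain ⟨i, hik⟩ := hi k
    beta_reduce
    rw [hlet k i hik, hbi k i hik]
    exact (hz i i.2).2.1
  · intro k
    beta_reduce
    rw [Int.add_emod_right, Int.add_ediv_of_dvd_right (dvd_refl _), Int.ediv_self hnz.ne',
      add_comm (k / n) 1, zpow_add, zpow_one, mul_assoc]
  · intro k i hik
    beta_reduce
    rw [hlet k i hik, hx]

theorem ax_of_mem {L G : Subgroup F} (hF : IsAmalgam L G) {R : Set F}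
    (hsep : IsHalfHMinusSeparatedSet L G R) {r : F} (hr : r ∈ R) :
    ∃ n g b, Ax L G r n g b ∧ Sep L G n g ∧ g 0 = 1 := by
  obtain ⟨h1, h2, n, x, hrep, ε, -, hs⟩ := hsep r hr
  have hle := len_le hrep
  rw [List.length_ofFn] at hle
  have hn2 : 2 ≤ n := by
    obtain ⟨m, hm⟩ := h2
    omega
  obtain ⟨b0, hz0⟩ := rep_zig hrep (Or.inl (by simpa using hn2))
  have hl := len_zig hF hz0 (by simp; omega)
  beta_reduce at hl
  rw [List.take_length, hrep.2, List.take_zero, List.prod_nil, inv_one, one_mul,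
    List.length_ofFn] at hl
  rw [hl] at h2
  obtain ⟨g, b, hax, hg0, hlet⟩ := ax_of_rep hn2 h2 hrep
  have hnz : (0 : ℤ) < n := by omega
  refine ⟨n, g, b, hax, ?_, hg0⟩
  · refine ⟨((ε : ℕ) : ℤ), fun i j hi hj hij u hu v hv he => ?_⟩
    have key : ∀ i : ℤ, 2 ∣ i - (ε : ℕ) → ∃ i' : Fin n, Even (i' : ℕ) ∧
        ((i' : ℕ) : ℤ) = (i - (ε : ℕ)) % n ∧ (((ε + i' : Fin n) : ℕ) : ℤ) = i % n := by
      intro i hi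
      have h3 := Int.emod_nonneg (i - (ε : ℕ)) hnz.ne'
      have h4 := Int.emod_lt_of_pos (i - (ε : ℕ)) hnz
      have h5 : (((i - (ε : ℕ)) % n).toNat : ℤ) = (i - (ε : ℕ)) % n := Int.toNat_of_nonneg h3
      refine ⟨⟨((i - (ε : ℕ)) % n).toNat, by omega⟩, ?_, h5, ?_⟩
      · have h6 : (2 : ℤ) ∣ (i - (ε : ℕ)) % n := by
          have h2' : (2 : ℤ) ∣ n := by
            obtain ⟨m, hm⟩ := h2
            exact ⟨m, by omega⟩
          rw [Int.emod_def]
          exact dvd_sub hi (Dvd.dvd.mul_right h2' _)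
        rw [even_iff_two_dvd]
        change 2 ∣ ((i - (ε : ℕ)) % n).toNat
        rw [← h5] at h6
        exact_mod_cast h6
      · rw [Fin.val_add]
        push_cast
        beta_reduce
        rw [h5, Int.add_emod_emod]
        congr 1; ring
    obtain ⟨i', a1, a2, a3⟩ := key i hi
    obtain ⟨j', c1, c2, c3⟩ := key j hj
    refine hs i' j' a1 c1 ?_ ?_
    · rintro rfl
      apply hij
      have := Int.ModEq.dvd (a := j) (b := i) (n := n) (by
        unfold Int.ModEq; rw [← a3, ← c3])
      exact this
    · rw [hlet i _ a3, hlet j _ c3] at he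
      rw [he]
      exact Set.mul_mem_mul (Set.mul_mem_mul hu rfl) hv

end AmalgamFormalization

namespace AmalgamFormalization

variable {F : Type u} [Group F]

/-- All conjugates of relators and their inverses. -/
def Rels (R : Set F) : Set F := {s | ∃ c, ∃ r ∈ R, s = c * r * c⁻¹ ∨ s = c * r⁻¹ * c⁻¹}

theorem rels_conj {R : Set F} (c : F) {s : F} (hs : s ∈ Rels R) : c * s * c⁻¹ ∈ Rels R := by
  obtain ⟨e, r, hr, h⟩ := hs
  refine ⟨c * e, r, hr, ?_⟩
  rcases h with rfl | rfl
  · left; group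
  · right; group

theorem rels_inv {R : Set F} {s : F} (hs : s ∈ Rels R) : s⁻¹ ∈ Rels R := by
  obtain ⟨e, r, hr, h⟩ := hs
  refine ⟨e, r, hr, ?_⟩
  rcases h with rfl | rfl
  · right; group
  · left; group

theorem rels_sub {R : Set F} {s : F} (hs : s ∈ Rels R) : s ∈ Subgroup.normalClosure R := by
  obtain ⟨e, r, hr, h⟩ := hs
  have h1 := Subgroup.subset_normalClosure hr
  have hN : (Subgroup.normalClosure R).Normal := Subgroup.normalClosure_normal
  rcases h with rfl | rfl
  · exact hN.conj_mem _ h1 e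
  · exact hN.conj_mem _ (inv_mem h1) e

theorem normalClosure_le_rels {R : Set F} {m : F} (hm : m ∈ Subgroup.normalClosure R) :
    m ∈ Subgroup.closure (Rels R) := by
  have : Subgroup.normalClosure R ≤ Subgroup.closure (Rels R) := by
    unfold Subgroup.normalClosure
    apply Subgroup.closure_mono
    intro x hx
    rw [Group.mem_conjugatesOfSet_iff] at hx
    obtain ⟨a, ha, hax⟩ := hx
    obtain ⟨c, hc⟩ := isConj_iff.1 hax
    exact ⟨c, a, ha, Or.inl hc.symm⟩
  exact this hm

theorem rels_ax {L G : Subgroup F} (hF : IsAmalgam L G) {R : Set F}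
    (hsep : IsHalfHMinusSeparatedSet L G R) {s : F} (hs : s ∈ Rels R) :
    ∃ n g b, Ax L G s n g b ∧ Sep L G n g := by
  obtain ⟨c, r, hr, h⟩ := hs
  obtain ⟨n, g, b, hax, hsp, -⟩ := ax_of_mem hF hsep hr
  rcases h with rfl | rfl
  · exact ⟨n, _, _, hax.conj c, hsp.conj c⟩
  · exact ⟨n, _, _, hax.inv.conj c, hsp.inv.conj c⟩

theorem hull_of_rels {L G : Subgroup F} {R : Set F} {s : F} (hs : s ∈ Rels R)
    (hw : IsWeaklyCyclicallyReduced L G s) : s ∈ symmetrizedHull L G R := by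
  intro S hS
  obtain ⟨h1, h2⟩ := hS
  obtain ⟨c, r, hr, h⟩ := hs
  rcases h with rfl | rfl
  · exact h2.1.2 c r (h1 hr) hw
  · exact h2.1.2 c r⁻¹ (h2.2 r (h1 hr)) hw

section SC

variable {L G : Subgroup F} {R : Set F} {lam : ℝ}

theorem sc_core (hF : IsAmalgam L G) (hlam6 : lam < 1 / 6)
    (hC : CondC' L G (symmetrizedHull L G R) lam) {r s : F} (hr : r ∈ Rels R) (hs : s ∈ Rels R)
    (hrs : s ≠ r) {n m : ℕ} {g g' : ℤ → F} {b b' : ℤ → Bool} (ha : Ax L G r n g b)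
    (ha' : Ax L G s m g' b') (h0 : g 0 = 1) (h0' : g' 0 = 1) (l : ℕ) (hl : 1 ≤ l)
    (hpt : ∀ t : ℕ, t ≤ l → pt L G g b (-1 + t) = pt L G g' b' (-1 + t)) :
    (l : ℝ) < lam * n := by
  obtain ⟨c1, -, c3⟩ := ha.cyc hF h0
  obtain ⟨c1', -, c3'⟩ := ha'.cyc hF h0'
  have hrh := hull_of_rels hr c3
  have hsh := hull_of_rels hs c3'
  have hn := ha.pos
  have hm := ha'.pos
  have claim : ∀ k : ℕ, 1 ≤ k → k ≤ l → k ≤ n → k ≤ m →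
      (∃ x, DotEq L G r (g k) x) ∧ (∃ y, DotEq L G s (g k) y) ∧ len L G (g k) = k := by
    intro k h1 h2 h3 h4
    have hgn : g n = r := by
      have := ha.per 0
      rw [zero_add] at this
      rw [this, h0, mul_one]
    have hgm : g' m = s := by
      have := ha'.per 0
      rw [zero_add] at this
      rw [this, h0', mul_one]
    have hlen : len L G (g k) = k := by
      have := ha.len_eq hF 0 k h1
      rwa [zero_add, h0, inv_one, one_mul] at this
    have hrest : len L G ((g k)⁻¹ * g n) ≤ n - k := by
      rcases Nat.lt_or_ge k n with h5 | h5
      · have := ha.len_eq hF k (n - k) (by omega)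
        rw [show (k : ℤ) + ((n - k : ℕ) : ℤ) = n by omega] at this
        exact this.le
      · have : k = n := by omega
        subst this
        rw [inv_mul_cancel, len_one]; omega
    have hrest' : len L G ((g' k)⁻¹ * g' m) ≤ m - k := by
      rcases Nat.lt_or_ge k m with h5 | h5
      · have := ha'.len_eq hF k (m - k) (by omega)
        rw [show (k : ℤ) + ((m - k : ℕ) : ℤ) = m by omega] at this
        exact this.le
      · have : k = m := by omega
        subst this
        rw [inv_mul_cancel, len_one]; omega
    have hmid : len L G ((g k)⁻¹ * g' k) ≤ 1 := by
      have h6 := hpt k h2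
      have e1 := ha.pt_next (-1 + k)
      have e2 := ha'.pt_next (-1 + k)
      rw [show -1 + (k : ℤ) + 1 = k by ring] at e1 e2
      rw [← e1, ← e2, vert_eq] at h6
      exact len_fac h6.2
    refine ⟨⟨(g k)⁻¹ * r, by group, ?_, ?_⟩, ⟨(g k)⁻¹ * s, by group, ?_, ?_⟩, hlen⟩
    · rw [← hgn] at c1 ⊢
      omega
    · have := len_mul_le hF (g k) ((g k)⁻¹ * r)
      rwa [mul_inv_cancel_left] at this
    · have h7 := len_mul_le hF ((g k)⁻¹ * g' k) ((g' k)⁻¹ * g' m)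
      have e : (g k)⁻¹ * g' k * ((g' k)⁻¹ * g' m) = (g k)⁻¹ * g' m := by group
      rw [e] at h7
      rw [← hgm] at c1' ⊢
      omega
    · have := len_mul_le hF (g k) ((g k)⁻¹ * s)
      rwa [mul_inv_cancel_left] at this
  have hn' : (1 : ℝ) ≤ n := by exact_mod_cast hn
  have hm' : (1 : ℝ) ≤ m := by exact_mod_cast hm
  obtain ⟨k1, k2, k3⟩ := claim (min l (min n m)) (by simp; omega) (by simp) (by simp) (by simp)
  have p1 := hC.2 r hrh _ ⟨s, hsh, hrs, k1, k2⟩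
  have p2 := hC.2 s hsh _ ⟨r, hrh, hrs.symm, k2, k1⟩
  rw [k3, c1] at p1
  rw [k3, c1'] at p2
  rcases le_total l (min n m) with q | q
  · rwa [min_eq_left q] at p1
  · rw [min_eq_right q] at p1 p2
    exfalso
    rcases le_total n m with q' | q'
    · rw [min_eq_left q'] at p1
      nlinarith
    · rw [min_eq_right q'] at p2
      nlinarith

theorem sc_lines (hF : IsAmalgam L G) (hlam6 : lam < 1 / 6)
    (hC : CondC' L G (symmetrizedHull L G R) lam) {r s : F} (hr : r ∈ Rels R) (hs : s ∈ Rels R)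
    (hrs : s ≠ r) {n m : ℕ} {g g' : ℤ → F} {b b' : ℤ → Bool} (ha : Ax L G r n g b)
    (ha' : Ax L G s m g' b') {i i' : ℤ} {l : ℕ} (hl : 1 ≤ l)
    (h1 : pt L G g b i = pt L G g' b' i') (h2 : pt L G g b (i + l) = pt L G g' b' (i' + l)) :
    (l : ℝ) < lam * n := by
  -- the whole segment agrees
  have hpt : ∀ t : ℕ, t ≤ l → pt L G g b (i + t) = pt L G g' b' (i' + t) := by
    intro t ht
    refine (bd_tree hF).uniq (a := pt L G g b i) (c := pt L G g b (i + l)) ?_ ?_ ?_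
    · unfold Btw
      simp only [ha.dist_pt hF]; omega
    · unfold Btw
      rw [h1, h2]
      simp only [ha'.dist_pt hF]; omega
    · conv_rhs => rw [h1]
      rw [ha.dist_pt hF, ha'.dist_pt hF]; omega
  set γ := g (i + 1) with hγ
  have hu : (g' (i' + 1))⁻¹ * γ ∈ L ⊓ G := by
    have e1 := hpt 0 (by omega)
    have e2 := hpt 1 hl
    simp only [Nat.cast_zero, add_zero, Nat.cast_one] at e1 e2
    rw [← ha.pt_next, ← ha'.pt_next] at e1
    unfold pt at e2
    rw [vert_eq] at e1 e2
    have f1 := inv_mem e1.2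
    have f2 := inv_mem e2.2
    rw [ha.alt] at f2
    rw [mem_inf_fac (b i)]
    constructor
    · simpa [hγ] using f1
    · simpa [hγ] using f2
  have A1 := (ha.shift (i + 1)).conj γ⁻¹
  have A2 := ((ha'.mulH hu).shift (i' + 1)).conj γ⁻¹
  refine sc_core hF hlam6 hC (rels_conj γ⁻¹ hr) (rels_conj γ⁻¹ hs) ?_ A1 A2 ?_ ?_ l hl ?_
  · intro he
    apply hrs
    simpa using he
  · simp [hγ]
  · simp
  · intro t ht
    have e := hpt t ht
    have hu' : ∀ k, vert L G (b' k) (g' k * ((g' (i' + 1))⁻¹ * γ)) = vert L G (b' k) (g' k) := by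
      intro k
      rw [vert_eq]
      refine ⟨rfl, ?_⟩
      have := ((mem_inf_fac (b' k)).1 (inv_mem hu)).1
      have e : (g' k * ((g' (i' + 1))⁻¹ * γ))⁻¹ * g' k = ((g' (i' + 1))⁻¹ * γ)⁻¹ := by group
      rwa [e]
    unfold pt at *
    beta_reduce
    rw [show -1 + (t : ℤ) + (i + 1) = i + t by ring, show -1 + (t : ℤ) + (i' + 1) = i' + t by ring]
    rw [← smul_vert, ← smul_vert, hu', e]

theorem sc_main (hF : IsAmalgam L G) (hlam0 : 0 < lam) (hlam6 : lam < 1 / 6)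
    (hsep : IsHalfHMinusSeparatedSet L G R)
    (hC : CondC' L G (symmetrizedHull L G R) lam) {r s : F} (hr : r ∈ Rels R) (hs : s ∈ Rels R)
    (hrs : s ≠ r) (hrs' : s ≠ r⁻¹) {x y : BV L G} (hx : x ∈ MinSet L G r) (hx' : x ∈ MinSet L G s)
    (hy : y ∈ MinSet L G r) (hy' : y ∈ MinSet L G s) :
    (bd L G x y : ℝ) < lam * trl L G r := by
  obtain ⟨n, g, b, ha, -⟩ := rels_ax hF hsep hr
  obtain ⟨m, g', b', ha', -⟩ := rels_ax hF hsep hs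
  rw [ha.minSet_eq hF] at hx hy
  rw [ha'.minSet_eq hF] at hx' hy'
  rw [ha.trl_eq hF]
  obtain ⟨i, hi⟩ := hx
  obtain ⟨j, hj⟩ := hy
  obtain ⟨i', hi'⟩ := hx'
  obtain ⟨j', hj'⟩ := hy'
  have hn : (0 : ℝ) < n := by exact_mod_cast ha.pos
  have d1 := ha.dist_pt hF i j
  have d2 := ha'.dist_pt hF i' j'
  rw [hi, hj] at d1
  rw [hi', hj'] at d2
  rcases Nat.eq_zero_or_pos (bd L G x y) with h0 | h0
  · rw [h0]; push_cast; positivity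
  set l := bd L G x y with hl
  have ainv := ha'.inv
  have hinv : ∀ k : ℤ, pt L G (fun k => g' (-k)) (fun k => b' (-k - 1)) k = pt L G g' b' (-k - 1) := by
    intro k
    unfold pt
    beta_reduce
    have := ha'.pt_next (-k - 1)
    rw [show -k - 1 + 1 = -k by ring] at this
    rw [this]; rfl
  have hrs2 : s⁻¹ ≠ r := fun h => hrs' (by rw [← h, inv_inv])
  rcases le_total i j with hij | hij <;> rcases le_total i' j' with hij' | hij'
  · refine sc_lines hF hlam6 hC hr hs hrs ha ha' (i := i) (i' := i') h0 (by rw [hi, hi']) ?_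
    rw [show i + (l : ℤ) = j by omega, show i' + (l : ℤ) = j' by omega, hj, hj']
  · refine sc_lines hF hlam6 hC hr (rels_inv hs) hrs2 ha ainv (i := i) (i' := -i' - 1) h0 ?_ ?_
    · rw [hinv, hi, show -(-i' - 1) - 1 = i' by ring, hi']
    · rw [hinv, show i + (l : ℤ) = j by omega, show -(-i' - 1 + (l : ℤ)) - 1 = j' by omega, hj, hj']
  · refine sc_lines hF hlam6 hC hr (rels_inv hs) hrs2 ha ainv (i := j) (i' := -j' - 1) h0 ?_ ?_
    · rw [hinv, hj, show -(-j' - 1) - 1 = j' by ring, hj']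
    · rw [hinv, show j + (l : ℤ) = i by omega, show -(-j' - 1 + (l : ℤ)) - 1 = i' by omega, hi, hi']
  · refine sc_lines hF hlam6 hC hr hs hrs ha ha' (i := j) (i' := j') h0 (by rw [hj, hj']) ?_
    rw [show j + (l : ℤ) = i by omega, show j' + (l : ℤ) = i' by omega, hi, hi']

theorem mill (hF : IsAmalgam L G) (hlam0 : 0 < lam) (hlam6 : lam < 1 / 6)
    (hsep : IsHalfHMinusSeparatedSet L G R)
    (hC : CondC' L G (symmetrizedHull L G R) lam) :
    Mill (bd L G) (Rels R) (MinSet L G) (fun r => (trl L G r : ℝ))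
      (fun r => lam * trl L G r) where
  tree := bd_tree hF
  iso := bd_smul hF
  conj g r hr := rels_conj g hr
  Aconj g r x hx := by
    intro y
    have h1 := hx (g⁻¹ • y)
    rw [← bd_smul hF g x, ← bd_smul hF g (g⁻¹ • y)] at h1
    simpa [mul_smul] using h1
  Ainv r := by
    have key : ∀ (r : F) (x : BV L G), bd L G x (r⁻¹ • x) = bd L G x (r • x) := by
      intro r x
      rw [← bd_smul hF r x, smul_inv_smul, (bd_tree hF).symm]
    ext x
    unfold MinSet
    simp only [Set.mem_setOf_eq, key]
  conv r hr := by
    obtain ⟨n, g, b, ha, -⟩ := rels_ax hF hsep hr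
    rw [ha.minSet_eq hF]
    exact ha.conv hF
  ne r hr := by
    obtain ⟨n, g, b, ha, -⟩ := rels_ax hF hsep hr
    rw [ha.minSet_eq hF]
    exact ⟨_, 0, rfl⟩
  κconj g r hr := by
    obtain ⟨n, g', b, ha, -⟩ := rels_ax hF hsep hr
    rw [ha.trl_eq hF, (ha.conj g).trl_eq hF]
  κinv r hr := by
    obtain ⟨n, g', b, ha, -⟩ := rels_ax hF hsep hr
    rw [ha.trl_eq hF, ha.inv.trl_eq hF]
  κpos r hr := by
    obtain ⟨n, g', b, ha, -⟩ := rels_ax hF hsep hr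
    rw [ha.trl_eq hF]
    have hn : (0 : ℝ) < n := by exact_mod_cast ha.pos
    positivity
  six r hr := by
    obtain ⟨n, g', b, ha, -⟩ := rels_ax hF hsep hr
    rw [ha.trl_eq hF]
    have hn : (0 : ℝ) < n := by exact_mod_cast ha.pos
    nlinarith
  disp r hr e he x := by
    obtain ⟨n, g', b, ha, -⟩ := rels_ax hF hsep hr
    rw [ha.trl_eq hF]
    exact_mod_cast ha.disp_ge hF x he
  sc r hr s hs h1 h2 x y hx hx' hy hy' := sc_main hF hlam0 hlam6 hsep hC hr hs h1 h2 hx hx' hy hy'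

end SC

end AmalgamFormalization

namespace AmalgamFormalization

variable {F : Type u} [Group F]

/-! ### The final argument -/

theorem fold_false {L G : Subgroup F} {r : F} {n : ℕ} {g : ℤ → F} {b : ℤ → Bool}
    (h : Ax L G r n g b) (hs : Sep L G n g) (hn : 5 ≤ n) (k0 : ℤ) (γ : F)
    (hγ : ∀ t : ℤ, 0 ≤ t → t ≤ 3 → γ • pt L G g b (k0 - t) = pt L G g b (k0 + t)) : False := by
  have key : ∀ t : ℤ, 0 ≤ t → t ≤ 2 → (γ * g (k0 - t))⁻¹ * g (k0 + t + 1) ∈ L ⊓ G := by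
    intro t h0 h2
    have h1 := hγ t h0 (by omega)
    rw [← h.pt_next (k0 + t)] at h1
    unfold pt at h1
    rw [smul_vert, vert_eq] at h1
    have h3 := hγ (t + 1) (by omega) (by omega)
    rw [← h.pt_next (k0 - (t + 1)), smul_vert] at h3
    unfold pt at h3
    rw [vert_eq, show k0 - (t + 1) + 1 = k0 - t by ring, show k0 + (t + 1) = k0 + t + 1 by ring]
      at h3
    rw [mem_inf_fac (b (k0 - t))]
    refine ⟨h1.2, ?_⟩
    have h4 := h.alt (k0 - (t + 1))
    rw [show k0 - (t + 1) + 1 = k0 - t by ring] at h4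
    rw [h4]; simpa using h3.2
  have key2 : ∀ t : ℤ, 1 ≤ t → t ≤ 2 → ∃ u ∈ L ⊓ G, ∃ w ∈ L ⊓ G,
      ((g (k0 + t))⁻¹ * g (k0 + t + 1))⁻¹ = u * ((g (k0 - t))⁻¹ * g (k0 - t + 1)) * w := by
    intro t h1 h2
    have a1 := key t (by omega) h2
    have a2 := key (t - 1) (by omega) (by omega)
    rw [show k0 - (t - 1) = k0 - t + 1 by ring, show k0 + (t - 1) + 1 = k0 + t by ring] at a2
    refine ⟨_, inv_mem a1, _, a2, ?_⟩
    group
  obtain ⟨ε, hs⟩ := hs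
  have nd : ∀ t : ℤ, 1 ≤ t → t ≤ 2 → ¬ (n : ℤ) ∣ (k0 + t) - (k0 - t) := by
    intro t h1 h2 hd
    have := Int.le_of_dvd (by omega) hd
    omega
  by_cases hp : (2 : ℤ) ∣ k0 + 1 - ε
  · obtain ⟨u, hu, w, hw, he⟩ := key2 1 le_rfl (by norm_num)
    exact hs (k0 + 1) (k0 - 1) hp (by omega) (nd 1 le_rfl (by norm_num)) u hu w hw he
  · obtain ⟨u, hu, w, hw, he⟩ := key2 2 (by norm_num) le_rfl
    exact hs (k0 + 2) (k0 - 2) (by omega) (by omega) (nd 2 (by norm_num) le_rfl) u hu w hw he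

theorem min_half {L G : Subgroup F} (hF : IsAmalgam L G) {r : F} {n : ℕ} {g : ℤ → F} {b : ℤ → Bool}
    (h : Ax L G r n g b) {v p X Y : BV L G} (hm1 : bd L G v p ≤ bd L G v (r • p))
    (hm2 : bd L G v p ≤ bd L G v (r⁻¹ • p)) (hX : X ∈ MinSet L G r) (hY : Y ∈ MinSet L G r)
    (hd : bd L G v p = bd L G v X + bd L G X Y + bd L G Y p) : 2 * bd L G X Y ≤ n := by
  rw [h.minSet_eq hF] at hX hY
  obtain ⟨i, rfl⟩ := hX
  obtain ⟨j, rfl⟩ := hY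
  have T := bd_tree hF
  have key : ∀ s : F, bd L G v p ≤ bd L G v (s • p) →
      bd L G (pt L G g b i) (pt L G g b j) ≤ bd L G (pt L G g b i) (s • pt L G g b j) := by
    intro s hs
    have h1 := T.tri v (pt L G g b i) (s • p)
    have h2 := T.tri (pt L G g b i) (s • pt L G g b j) (s • p)
    rw [bd_smul hF] at h2
    omega
  have k1 := key _ hm1
  have k2 := key _ hm2
  have e := h.zpow_pt (-1) j
  rw [zpow_neg_one] at e
  rw [h.smul_pt, h.dist_pt hF, h.dist_pt hF] at k1
  rw [e, h.dist_pt hF, h.dist_pt hF] at k2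
  rw [h.dist_pt hF]
  have := h.pos
  omega

theorem mal_fix {L G : Subgroup F} (hF : IsAmalgam L G) (hmal : MalnormalIn (L ⊓ G) L)
    {γ : F} {v p : BV L G} (hv : v.1 = false) (hp : p.1 = false) (hne : v ≠ p)
    (h1 : γ • v = v) (h2 : γ • p = p) : γ = 1 := by
  have T := bd_tree hF
  have hfix : ∀ z, Btw (bd L G) v z p → γ • z = z := by
    intro z hz
    refine T.uniq (a := v) (c := p) ?_ hz ?_
    · have := hz
      unfold Btw at this ⊢
      rw [← bd_smul hF γ v z, ← bd_smul hF γ z p, h1, h2] at this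
      exact this
    · conv_lhs => rw [← h1]
      rw [bd_smul hF]
  obtain ⟨w, a1, a2⟩ := T.step v p hne
  have hadj : (BS L G).Adj v w := SimpleGraph.dist_eq_one_iff_adj.1 a1
  have hwt : w.1 = true := by rw [adj_fst hadj, hv]; rfl
  have hwp : w ≠ p := by rintro rfl; rw [hwt] at hp; cases hp
  obtain ⟨z, c1, c2⟩ := T.step w p hwp
  have hadj2 : (BS L G).Adj w z := SimpleGraph.dist_eq_one_iff_adj.1 c1
  have hvz : v ≠ z := by
    rintro rfl
    have := T.symm w v
    omega
  have fw := hfix w a2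
  have fz : γ • z = z := by
    apply hfix
    unfold Btw
    have := T.tri v w z
    have := T.tri v z p
    omega
  obtain ⟨a, ba, rfl, rfl⟩ := hadj
  have : ba = false := hv
  subst this
  obtain ⟨c, bc, e1, rfl⟩ := hadj2
  rw [vert_eq] at e1
  obtain ⟨e2, e3⟩ := e1
  simp only [Bool.not_false] at e2
  subst e2
  rw [smul_vert, vert_eq] at h1 fw fz
  rw [Ne, vert_eq] at hvz
  simp only [Bool.not_true, Bool.not_false, Fac] at *
  have e3' : a⁻¹ * c ∈ L := e3
  have f1 : (γ * a)⁻¹ * a ∈ G := h1.2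
  have f2 : (γ * a)⁻¹ * a ∈ L := fw.2
  have f3 : (γ * c)⁻¹ * c ∈ G := fz.2
  have f4 : (γ * c)⁻¹ * c ∈ L := by
    have := mul_mem (mul_mem (inv_mem e3') f2) e3'
    convert this using 1; group
  have hnot : a⁻¹ * c ∉ L ⊓ G := fun hh => hvz ⟨trivial, hh.2⟩
  have := hmal _ e3' hnot _ (Subgroup.mem_inf.2 ⟨f4, f3⟩) (by
    have : a⁻¹ * c * ((γ * c)⁻¹ * c) * (a⁻¹ * c)⁻¹ = (γ * a)⁻¹ * a := by group
    rw [this]; exact ⟨f2, f1⟩)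
  have e : c * ((γ * c)⁻¹ * c) * c⁻¹ = γ⁻¹ := by group
  rw [this] at e
  simpa using e.symm

theorem final_line {L G : Subgroup F} (hF : IsAmalgam L G) {r : F} {n : ℕ} {g : ℤ → F}
    {b : ℤ → Bool} (h : Ax L G r n g b) (hs : Sep L G n g) (hn : 5 ≤ n) {γ : F}
    {v m : BV L G} {i j : ℤ} (hij : i ≤ j) (hγm : γ • m = m)
    (hm : Btw (bd L G) (pt L G g b i) m (pt L G g b j))
    (h1 : bd L G v m = bd L G v (pt L G g b i) + bd L G (pt L G g b i) m)
    (h2 : bd L G m (γ • v) = bd L G m (pt L G g b j) + bd L G (pt L G g b j) (γ • v))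
    (h3 : 3 ≤ bd L G (pt L G g b i) m) (h4 : 3 ≤ bd L G m (pt L G g b j)) : False := by
  have T := bd_tree hF
  obtain ⟨e, -⟩ := h.btw_eq hF hij hm
  generalize i + (bd L G (pt L G g b i) m : ℤ) = k0 at e
  subst e
  have hm' := hm
  unfold Btw at hm'
  simp only [h.dist_pt hF] at h3 h4 hm' h1 h2
  refine fold_false h hs hn k0 γ fun t ht0 ht3 => ?_
  refine T.uniq (a := pt L G g b k0) (c := γ • v) ?_ ?_ ?_
  · unfold Btw
    have e1 : bd L G (pt L G g b k0) (γ • pt L G g b (k0 - t)) = t.natAbs := by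
      conv_lhs => rw [← hγm]
      rw [bd_smul hF, h.dist_pt hF]; omega
    have e2 : bd L G (pt L G g b k0) (γ • v) = bd L G v (pt L G g b k0) := by
      conv_lhs => rw [← hγm]
      rw [bd_smul hF, T.symm]
    rw [e1, e2, bd_smul hF, T.symm]
    have a1 := T.tri v (pt L G g b i) (pt L G g b (k0 - t))
    have a2 := T.tri v (pt L G g b (k0 - t)) (pt L G g b k0)
    rw [h.dist_pt hF] at a1 a2
    omega
  · unfold Btw
    have a1 := T.tri (pt L G g b (k0 + t)) (pt L G g b j) (γ • v)
    have a2 := T.tri (pt L G g b k0) (pt L G g b (k0 + t)) (γ • v)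
    rw [h.dist_pt hF] at a1 a2
    rw [h.dist_pt hF]
    omega
  · conv_lhs => rw [← hγm]
    rw [bd_smul hF, h.dist_pt hF, h.dist_pt hF]; omega

theorem rels_big {L G : Subgroup F} (hF : IsAmalgam L G) {R : Set F} {lam : ℝ} (hlam0 : 0 < lam)
    (hlam6 : lam < 1 / 6)
    (hC : CondC' L G (symmetrizedHull L G R) lam)
    (hbig : ∀ r ∈ symmetrizedHull L G R, IsCyclicallyReduced L G r →
        (4 : ℝ) < (1 - 6 * lam) * (len L G r : ℝ))
    {s : F} (hs : s ∈ Rels R) {n : ℕ} {g : ℤ → F} {b : ℤ → Bool} (h : Ax L G s n g b) :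
    5 ≤ n ∧ (4 : ℝ) < (1 - 6 * lam) * n := by
  have h' := h.conj (g 0)⁻¹
  obtain ⟨a1, a2, a3⟩ := h'.cyc hF (by simp)
  have hh := hull_of_rels (rels_conj (g 0)⁻¹ hs) a3
  have h4 := hbig _ hh a2
  have h5 := hC.1 _ hh
  rw [a1] at h4 h5
  refine ⟨?_, h4⟩
  have : (4 : ℝ) < n := by nlinarith [(Nat.cast_nonneg n : (0 : ℝ) ≤ n)]
  exact_mod_cast this

theorem final_core {L G : Subgroup F} (hF : IsAmalgam L G) {R : Set F} {lam : ℝ} (hlam0 : 0 < lam)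
    (hlam6 : lam < 1 / 6) (hsep : IsHalfHMinusSeparatedSet L G R)
    (hC : CondC' L G (symmetrizedHull L G R) lam)
    (hbig : ∀ r ∈ symmetrizedHull L G R, IsCyclicallyReduced L G r →
        (4 : ℝ) < (1 - 6 * lam) * (len L G r : ℝ))
    {γ n1 : F} {v p : BV L G} (hn1 : n1 ∈ Subgroup.normalClosure R) (hne : n1 ≠ 1)
    (hp : γ • p = p) (hv : γ • v = n1 • v)
    (hmin : ∀ s ∈ Rels R, bd L G v p ≤ bd L G v (s • p)) : False := by
  have T := bd_tree hF
  have M := mill hF hlam0 hlam6 hsep hC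
  obtain ⟨r, hr, X, Y, hX, hY, hd, hl⟩ := M.greendlinger v n1 (normalClosure_le_rels hn1) hne
  rw [← hv] at hd
  obtain ⟨n, g, b, h, hs⟩ := rels_ax hF hsep hr
  obtain ⟨hn, hn4⟩ := rels_big hF hlam0 hlam6 hC hbig hr h
  simp only [h.trl_eq hF] at hl
  obtain ⟨m, m1, m2, m3⟩ := T.med v (γ • v) p
  have hpv : bd L G (γ • v) p = bd L G v p := by
    conv_lhs => rw [← hp]
    rw [bd_smul hF]
  have hγm : γ • m = m := by
    refine T.uniq (a := p) (c := γ • v) ?_ (T.btw_symm m3) ?_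
    · have := M.iso_btw (T.btw_symm m2) γ
      rwa [hp] at this
    · conv_lhs => rw [← hp]
      rw [bd_smul hF]
  -- pieces on `[v, p]`
  have half1 : ∀ X Y : BV L G, X ∈ MinSet L G r → Y ∈ MinSet L G r →
      bd L G v p = bd L G v X + bd L G X Y + bd L G Y p → 2 * bd L G X Y ≤ n :=
    fun X Y hX hY hd => min_half hF h (hmin r hr) (hmin _ (rels_inv hr)) hX hY hd
  have half2 : ∀ X Y : BV L G, X ∈ MinSet L G r → Y ∈ MinSet L G r →
      bd L G p (γ • v) = bd L G p X + bd L G X Y + bd L G Y (γ • v) → 2 * bd L G X Y ≤ n := by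
    intro X Y hX hY hd
    have hr' := rels_conj γ⁻¹ hr
    have := min_half hF (h.conj γ⁻¹) (v := v) (p := p) (X := γ⁻¹ • Y) (Y := γ⁻¹ • X)
      (hmin _ hr') (hmin _ (rels_inv hr')) (M.Aconj _ _ _ hY) (M.Aconj _ _ _ hX) ?_
    · rwa [bd_smul hF, T.symm] at this
    · rw [bd_smul hF, T.symm Y X, ← bd_smul hF γ v (γ⁻¹ • Y), ← bd_smul hF γ (γ⁻¹ • X) p, hp,
        smul_inv_smul, smul_inv_smul, T.symm (γ • v) Y, T.symm X p, ← hpv, T.symm (γ • v) p]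
      omega
  have hl' : (n : ℝ) < 2 * bd L G X Y := by nlinarith
  have hl'' : n < 2 * bd L G X Y := by exact_mod_cast hl'
  have sXm := T.symm X m
  have sYm := T.symm Y m
  have sXY := T.symm X Y
  have t0 := T.tri v X Y
  have t0' := T.tri X Y (γ • v)
  have tm1 := T.tri v X (γ • v)
  have tm2 := T.tri v Y (γ • v)
  have hvX : Btw (bd L G) v X (γ • v) := by unfold Btw; omega
  have hvY : Btw (bd L G) v Y (γ • v) := by unfold Btw; omega
  have hvm : Btw (bd L G) v m (γ • v) := m1
  have s3 := T.symm (γ • v) m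
  have s4 := T.symm m p
  have s5 := T.symm (γ • v) p
  have cX := T.btw_cover hvm X
  have cY := T.btw_cover hvm Y
  unfold Btw at hvX hvY cX cY
  -- `m` is not before `X`, nor after `Y`
  have mY : bd L G v Y = bd L G v m + bd L G m Y := by
    rcases cY with cY | cY
    · exact cY.symm
    · exfalso
      have := half1 X Y hX hY (by
        have := T.tri v Y m
        have := T.tri Y m p
        have := T.tri v X p
        have := T.tri X Y p
        have := T.tri v Y p
        omega)
      omega
  have mX : bd L G v m = bd L G v X + bd L G X m := by
    rcases cX with cX | cX
    · exfalso
      have := half2 X Y hX hY (by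
        have := T.tri p m X
        have := T.tri p X (γ • v)
        have := T.tri p Y (γ • v)
        have := T.tri X Y (γ • v)
        omega)
      omega
    · omega
  have hXmY : Btw (bd L G) X m Y := by unfold Btw; omega
  have hmA : m ∈ MinSet L G r := M.conv r hr X hX Y hY m hXmY
  have q1 := half1 X m hX hmA (by omega)
  have q2 := half2 m Y hmA hY (by omega)
  unfold Btw at hXmY
  have q1' : (2 : ℝ) * bd L G X m ≤ n := by exact_mod_cast q1
  have q2' : (2 : ℝ) * bd L G m Y ≤ n := by exact_mod_cast q2
  have q3 : (bd L G X m : ℝ) + bd L G m Y = bd L G X Y := by exact_mod_cast hXmY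
  have g1 : 3 ≤ bd L G X m := by
    have : (2 : ℝ) < bd L G X m := by nlinarith
    exact_mod_cast this
  have g2 : 3 ≤ bd L G m Y := by
    have : (2 : ℝ) < bd L G m Y := by nlinarith
    exact_mod_cast this
  have hmv : bd L G m (γ • v) = bd L G m Y + bd L G Y (γ • v) := by omega
  rw [h.minSet_eq hF] at hX hY
  obtain ⟨i, rfl⟩ := hX
  obtain ⟨j, rfl⟩ := hY
  rcases le_total i j with hij | hij
  · exact final_line hF h hs hn hij hγm hXmY mX hmv g1 g2
  · have hrev : ∀ k, pt L G g b k = pt L G (fun k => g (-k)) (fun k => b (-k - 1)) (-k - 1) := by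
      intro k
      rw [← h.pt_next k]
      unfold pt
      congr 1
      · congr 1; ring
      · congr 1; ring
    rw [hrev i, hrev j] at *
    exact final_line hF h.inv hs.inv hn (by omega) hγm hXmY mX hmv g1 g2

end AmalgamFormalization



namespace AmalgamFormalization

/-- Lemma 4.1 (preservation of malnormality): if `H = L ⊓ G` is malnormal in `L`, `R` is a
half `H⁻`-separated set whose symmetrized hull satisfies `C'(λ)` for some `0 < λ < 1/6`
with `(1 - 6λ)|r| > 4` for all cyclically reduced `r` in the hull, and `N` is the normal
closure of `R`, then `x y x⁻¹ ∉ GN` for all `x ∉ GN` and `y ∈ G \ {e}`. -/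
theorem conj_notMem_of_malnormal
    {F : Type u} [Group F] (L G : Subgroup F) (hF : IsAmalgam L G)
    (R : Set F) (lam : ℝ) (hlam0 : 0 < lam) (hlam6 : lam < 1 / 6)
    (hsep : IsHalfHMinusSeparatedSet L G R)
    (hC : CondC' L G (symmetrizedHull L G R) lam)
    (hbig : ∀ r ∈ symmetrizedHull L G R, IsCyclicallyReduced L G r →
        (4 : ℝ) < (1 - 6 * lam) * (len L G r : ℝ))
    (hmal : MalnormalIn (L ⊓ G) L) :
    ∀ x : F, x ∉ (G : Set F) * ((Subgroup.normalClosure R : Subgroup F) : Set F) →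
      ∀ y ∈ G, y ≠ 1 →
        x * y * x⁻¹ ∉ (G : Set F) * ((Subgroup.normalClosure R : Subgroup F) : Set F) := by
  intro x hx y hy hy1 hmem
  have hN : (Subgroup.normalClosure R).Normal := Subgroup.normalClosure_normal
  classical
  have hex : ∃ k : ℕ, ∃ ν ∈ Subgroup.normalClosure R,
      bd L G (vert L G false 1) ((ν * x) • vert L G false 1) = k :=
    ⟨_, 1, one_mem _, rfl⟩
  obtain ⟨ν, hν, hk⟩ := Nat.find_spec hex
  have hleast : ∀ μ ∈ Subgroup.normalClosure R,
      bd L G (vert L G false 1) ((ν * x) • vert L G false 1) ≤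
        bd L G (vert L G false 1) ((μ * x) • vert L G false 1) := by
    intro μ hμ
    rw [hk]
    exact Nat.find_min' hex ⟨μ, hμ, rfl⟩
  obtain ⟨g, hg, w, hw, hgw⟩ := Set.mem_mul.1 hmem
  have hgv : g • vert L G false (1 : F) = vert L G false 1 := by
    rw [smul_vert, vert_eq]
    refine ⟨rfl, ?_⟩
    have : (g * 1)⁻¹ * 1 ∈ G := by simpa using hg
    exact this
  have hyv : y • vert L G false (1 : F) = vert L G false 1 := by
    rw [smul_vert, vert_eq]
    refine ⟨rfl, ?_⟩
    have : (y * 1)⁻¹ * 1 ∈ G := by simpa using hy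
    exact this
  have hpne : vert L G false (1 : F) ≠ (ν * x) • vert L G false 1 := by
    rw [smul_vert, Ne, vert_eq]
    rintro ⟨-, h⟩
    have h' : ν * x ∈ G := by
      have : (1 : F)⁻¹ * (ν * x * 1) ∈ G := h
      simpa using this
    apply hx
    refine Set.mem_mul.2 ⟨ν * x, h', (ν * x)⁻¹ * ν⁻¹ * (ν * x)⁻¹⁻¹,
      hN.conj_mem _ (inv_mem hν) _, by group⟩
  have hfixp : (ν * x * y * (ν * x)⁻¹) • ((ν * x) • vert L G false (1 : F)) =
      (ν * x) • vert L G false 1 := by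
    rw [← mul_smul]
    have e : ν * x * y * (ν * x)⁻¹ * (ν * x) = ν * x * y := by group
    rw [e, mul_smul, hyv]
  have hfixv : (ν * x * y * (ν * x)⁻¹) • vert L G false (1 : F) =
      (ν * (g * (w * ν⁻¹) * g⁻¹)) • vert L G false 1 := by
    conv_rhs => rw [← hgv, ← mul_smul]
    congr 1
    have e : ν * x * y * (ν * x)⁻¹ = ν * (x * y * x⁻¹) * ν⁻¹ := by group
    rw [e, ← hgw]; group
  have hn1 : ν * (g * (w * ν⁻¹) * g⁻¹) ∈ Subgroup.normalClosure R :=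
    mul_mem hν (hN.conj_mem _ (mul_mem hw (inv_mem hν)) _)
  by_cases h1 : ν * (g * (w * ν⁻¹) * g⁻¹) = 1
  · rw [h1, one_smul] at hfixv
    have := mal_fix hF hmal rfl rfl hpne hfixv hfixp
    apply hy1
    have e : y = (ν * x)⁻¹ * (ν * x * y * (ν * x)⁻¹) * (ν * x) := by group
    rw [e, this]; group
  · refine final_core hF hlam0 hlam6 hsep hC hbig hn1 h1 hfixp hfixv fun s hs => ?_
    rw [← mul_smul, ← mul_assoc]
    exact hleast _ (mul_mem (rels_sub hs) hν)

end AmalgamFormalization
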